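/- Assume L(ε) ~ ε^{-λ} and a(ε) ~ ε^{α} as ε → 0 with α, λ > 0 and λ + (d+1)α < 1, so that N = dim ℋ^{L,a} ~ ε^{−λ−(d+1)α}. Let Z^ε = ∫_{ℋ^{L,a}} exp( −ε^{-1} ∫_{D_L} F(h(z)) dz ) ν₁^ε(dh), equivalently Z^ε = (Z₁^ε)^{-1} exp(−C*/ε) ∫_{ℋ^{L,a}} exp(−ε^{-1} 𝓕(h)) 𝓛^N(dh). Then liminf_{ε→0} ε · log Z^ε ≥ −C*. -/

import Mathlib

open MeasureTheory Real Filter Topology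
open scoped ENNReal RealInnerProductSpace

noncomputable section

/-- `Eucl d` is the Euclidean space `ℝ^(d+1)`. -/
abbrev Eucl (d : ℕ) : Type := EuclideanSpace ℝ (Fin (d + 1))

/-- The unbounded domain `D = ℝ × (0,1)^d`, as a subset of `ℝ^(d+1)`. -/
def domD (d : ℕ) : Set (Eucl d) := {z | ∀ i : Fin d, z i.succ ∈ Set.Ioo (0 : ℝ) 1}

/-- The bounded domain `D_L = (-L,L) × (0,1)^d`. -/
def domDL (d : ℕ) (L : ℝ) : Set (Eucl d) :=
  {z | |z 0| < L ∧ ∀ i : Fin d, z i.succ ∈ Set.Ioo (0 : ℝ) 1}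

/-- The standing assumptions on the symmetric double well potential `F`. -/
structure IsStdPotential (F : ℝ → ℝ) : Prop where
  smooth : ContDiff ℝ 3 F
  symm : ∀ u, F (-u) = F u
  nonneg : ∀ u, 0 ≤ F u
  zero_iff : ∀ u, F u = 0 ↔ u = 1 ∨ u = -1
  deriv_zero_iff : ∀ u, deriv F u = 0 ↔ u = 0 ∨ u = 1 ∨ u = -1
  dd_zero_neg : deriv (deriv F) 0 < 0
  dd_one_pos : 0 < deriv (deriv F) 1
  dd_neg_one_pos : 0 < deriv (deriv F) (-1)

/-- The surface tension `C* = ∫_{-1}^1 √(2 F(u)) du`. -/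
def Cstar (F : ℝ → ℝ) : ℝ := ∫ u in (-1 : ℝ)..1, Real.sqrt (2 * F u)

/-- `m` is the optimal transition profile for the potential `F`: a solution of
`m' = √(2F(m))`, `m(±∞) = ±1`, `m(0) = 0`, with values in `[-1,1]`. -/
structure IsProfile (F m : ℝ → ℝ) : Prop where
  mem_Icc : ∀ x, m x ∈ Set.Icc (-1 : ℝ) 1
  ode : ∀ x, HasDerivAt m (Real.sqrt (2 * F (m x))) x
  limit_top : Tendsto m atTop (nhds 1)
  limit_bot : Tendsto m atBot (nhds (-1))
  zero : m 0 = 0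

/-- `z` is a point of the lattice `aℤ^(d+1)`. -/
def latticePt (d : ℕ) (a : ℝ) (z : Eucl d) : Prop := ∀ i, ∃ k : ℤ, z i = a * k

/-- The grid `D_{L,a} = cl(D_{L-a}) ∩ aℤ^(d+1)`. -/
def gridSet (d : ℕ) (L a : ℝ) : Set (Eucl d) :=
  {z | latticePt d a z ∧ |z 0| ≤ L - a ∧ ∀ i : Fin d, z i.succ ∈ Set.Icc (0 : ℝ) 1}

/-- `h` is piecewise linear w.r.t. the lattice of mesh `a`: it is continuous and affine on
each simplex of the standard (Kuhn) subdivision of each lattice cube into simplices. -/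
def IsPLGrid (d : ℕ) (a : ℝ) (h : Eucl d → ℝ) : Prop :=
  Continuous h ∧
  ∀ (p : Fin (d + 1) → ℤ) (σp : Equiv.Perm (Fin (d + 1))),
    ∃ φ : Eucl d →ᵃ[ℝ] ℝ,
      ∀ z : Eucl d, (∀ i, a * p i ≤ z i ∧ z i ≤ a * p i + a) →
        (∀ k l : Fin (d + 1), k ≤ l → z (σp l) - a * (p (σp l)) ≤ z (σp k) - a * (p (σp k))) →
        h z = φ z

/-- The discretized configuration space `ℋ^{L,a}` of piecewise linear functions with
boundary values `±1`, presented through the linear interpolation operator `interp0`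
(zero boundary values, determined by the values on the grid and vanishing at all other
lattice points) and the fixed piecewise linear profile `bc` implementing the `±1`
boundary values.  Thus `ℋ^{L,a} = {bc + interp0 g}` and `ℋ₀^{L,a} = {interp0 g}`, where
`g` ranges over all functions on the grid, and both spaces are identified with `ℝ^N`
via the coordinates `g`. -/
structure Disc (d : ℕ) (L a : ℝ) where
  gridFin : Fintype (gridSet d L a)
  interp0 : ((gridSet d L a) → ℝ) →ₗ[ℝ] ((Eucl d) → ℝ)
  bc : Eucl d → ℝ
  interp0_grid : ∀ (g) (z : Eucl d) (hz : z ∈ gridSet d L a), interp0 g z = g ⟨z, hz⟩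
  interp0_lattice : ∀ (g) (z : Eucl d), latticePt d a z → z ∉ gridSet d L a → interp0 g z = 0
  interp0_bd : ∀ (g) (z : Eucl d), L ≤ |z 0| → interp0 g z = 0
  interp0_pl : ∀ g, IsPLGrid d a (interp0 g)
  bc_grid : ∀ z ∈ gridSet d L a, bc z = 0
  bc_lattice_pos : ∀ z : Eucl d, latticePt d a z → z ∉ gridSet d L a → 0 < z 0 → bc z = 1
  bc_lattice_neg : ∀ z : Eucl d, latticePt d a z → z ∉ gridSet d L a → z 0 < 0 → bc z = -1
  bc_plus : ∀ z : Eucl d, L ≤ z 0 → bc z = 1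
  bc_minus : ∀ z : Eucl d, z 0 ≤ -L → bc z = -1
  bc_pl : IsPLGrid d a bc

/-- The number of grid points, `N = dim ℋ^{L,a}`. -/
def gridCard (d : ℕ) (L a : ℝ) (disc : Disc d L a) : ℕ :=
  letI := disc.gridFin; Fintype.card (gridSet d L a)

/-- Lebesgue measure `𝓛^N` on `ℋ^{L,a} ≅ ℝ^N` (in grid coordinates). -/
def gridVol (d : ℕ) (L a : ℝ) (disc : Disc d L a) : Measure ((gridSet d L a) → ℝ) :=
  letI := disc.gridFin; Measure.pi fun _ => (volume : Measure ℝ)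

/-- The element of `ℋ^{L,a}` with grid values `g` (extended by `±1` to all of `ℝ^(d+1)`). -/
def discFun (d : ℕ) (L a : ℝ) (disc : Disc d L a) (g : (gridSet d L a) → ℝ) : Eucl d → ℝ :=
  fun z => disc.bc z + disc.interp0 g z

/-- The Dirichlet energy `∫_{D_L} |∇h|²`. -/
def dirEnergy (d : ℕ) (L : ℝ) (h : Eucl d → ℝ) : ℝ := ∫ z in domDL d L, ‖fderiv ℝ h z‖ ^ 2

/-- The squared `H¹(D_L)` norm `∫_{D_L} |∇h|² + h²`. -/
def sobNormSq (d : ℕ) (L : ℝ) (h : Eucl d → ℝ) : ℝ :=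
  ∫ z in domDL d L, (‖fderiv ℝ h z‖ ^ 2 + (h z) ^ 2)

/-- The potential energy `∫_{D_L} F(h)`. -/
def potEnergy (d : ℕ) (L : ℝ) (F : ℝ → ℝ) (h : Eucl d → ℝ) : ℝ :=
  ∫ z in domDL d L, F (h z)

/-- The energy `∫_{D_L} ½|∇h|² + F(h)`. -/
def fullEnergy (d : ℕ) (L : ℝ) (F : ℝ → ℝ) (h : Eucl d → ℝ) : ℝ :=
  ∫ z in domDL d L, (1/2 * ‖fderiv ℝ h z‖ ^ 2 + F (h z))

/-- Normalization constant `Z₁^ε` of the Gaussian measure `ν₁^ε`. -/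
def Z1 (d : ℕ) (L a : ℝ) (disc : Disc d L a) (ε : ℝ) : ℝ :=
  ∫ g, Real.exp (-(1/(2*ε)) * dirEnergy d L (discFun d L a disc g)) ∂(gridVol d L a disc)

/-- Normalization constant `Z₂^ε` of the unscaled Gaussian measure `ν₂^ε`. -/
def Z2 (d : ℕ) (L a : ℝ) (disc : Disc d L a) : ℝ :=
  ∫ g, Real.exp (-(1/2) * dirEnergy d L (discFun d L a disc g)) ∂(gridVol d L a disc)

/-- Normalization constant `Z₃^{ε,κ}` of the massive Gaussian measure `ρ^ε_κ` on `ℋ₀^{L,a}`. -/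
def Z3 (d : ℕ) (L a : ℝ) (disc : Disc d L a) (ε κ : ℝ) : ℝ :=
  ∫ g, Real.exp (-(κ/(2*ε)) * sobNormSq d L (disc.interp0 g)) ∂(gridVol d L a disc)

/-- Normalization constant `Z^{L,a,ε}` of the Gibbs measure `μ^{L,a,ε}`. -/
def Zmu (d : ℕ) (L a : ℝ) (disc : Disc d L a) (F : ℝ → ℝ) (ε : ℝ) : ℝ :=
  ∫ g, Real.exp (-(1/ε) * fullEnergy d L F (discFun d L a disc g)) ∂(gridVol d L a disc)

/-- The Gibbs measure `μ^{L,a,ε}`, in grid coordinates. -/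
def gibbs (d : ℕ) (L a : ℝ) (disc : Disc d L a) (F : ℝ → ℝ) (ε : ℝ) :
    Measure ((gridSet d L a) → ℝ) :=
  (gridVol d L a disc).withDensity fun g =>
    ENNReal.ofReal
      (Real.exp (-(1/ε) * fullEnergy d L F (discFun d L a disc g)) / Zmu d L a disc F ε)

/-- The massive Gaussian measure `ρ^ε_κ` on `ℋ₀^{L,a}`, in grid coordinates. -/
def rhoMeas (d : ℕ) (L a : ℝ) (disc : Disc d L a) (ε κ : ℝ) :
    Measure ((gridSet d L a) → ℝ) :=
  (gridVol d L a disc).withDensity fun g =>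
    ENNReal.ofReal
      (Real.exp (-(κ/(2*ε)) * sobNormSq d L (disc.interp0 g)) / Z3 d L a disc ε κ)

/-- The Gaussian measure `ν₁^ε` (scaled discrete free field with `±1` boundary values),
in grid coordinates. -/
def nu1 (d : ℕ) (L a : ℝ) (disc : Disc d L a) (ε : ℝ) : Measure ((gridSet d L a) → ℝ) :=
  (gridVol d L a disc).withDensity fun g =>
    ENNReal.ofReal
      (Real.exp (-(1/(2*ε)) * dirEnergy d L (discFun d L a disc g)) / Z1 d L a disc ε)

/-- Sum of the squared grid values. -/
def sumSq (d : ℕ) (L a : ℝ) (disc : Disc d L a) (g : (gridSet d L a) → ℝ) : ℝ :=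
  letI := disc.gridFin; ∑ z, (g z) ^ 2

/-- The lattice point `a (p + 1_S)`. -/
def vtx (d : ℕ) (a : ℝ) (p : Fin (d + 1) → ℤ) (S : Finset (Fin (d + 1))) : Eucl d :=
  WithLp.toLp 2 fun j => a * p j + if j ∈ S then a else 0

lemma vtx_apply (d : ℕ) (a : ℝ) (p : Fin (d + 1) → ℤ) (S : Finset (Fin (d + 1))) (j) :
    vtx d a p S j = a * p j + if j ∈ S then a else 0 := rfl

lemma vtx_latticePt (d : ℕ) (a : ℝ) (p : Fin (d + 1) → ℤ) (S : Finset (Fin (d + 1))) :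
    latticePt d a (vtx d a p S) := by
  intro i
  by_cases h : i ∈ S
  · exact ⟨p i + 1, by simp [vtx_apply, h]; ring⟩
  · exact ⟨p i, by simp [vtx_apply, h]⟩

/-- The directions in which the position of `z` in the cell `a (p + [0,1]^(d+1))` strictly
exceeds its position in direction `i`. -/
def dirsAbove (d : ℕ) (a : ℝ) (p : Fin (d + 1) → ℤ) (z : Eucl d) (i : Fin (d + 1)) :
    Finset (Fin (d + 1)) :=
  Finset.univ.filter fun j => z i - a * p i < z j - a * p j

lemma mem_dirsAbove {d : ℕ} {a : ℝ} {p : Fin (d + 1) → ℤ} {z : Eucl d} {i j : Fin (d + 1)} :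
    j ∈ dirsAbove d a p z i ↔ z i - a * p i < z j - a * p j := by simp [dirsAbove]

/-- `z` lies in the interior of a Kuhn simplex of the cell with corner `a p`. -/
structure InCell (d : ℕ) (a : ℝ) (p : Fin (d + 1) → ℤ) (z : Eucl d) : Prop where
  pos : ∀ i, 0 < z i - a * p i
  lt : ∀ i, z i - a * p i < a
  inj : ∀ i j, z i - a * p i = z j - a * p j → i = j

/-- The increment of `h` over the edge in direction `i` of the Kuhn simplex containing `z`. -/
def edgeInc (d : ℕ) (a : ℝ) (p : Fin (d + 1) → ℤ) (h : Eucl d → ℝ) (z : Eucl d)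
    (i : Fin (d + 1)) : ℝ :=
  h (vtx d a p (insert i (dirsAbove d a p z i))) - h (vtx d a p (dirsAbove d a p z i))

lemma vtx_insert_sub (d : ℕ) (a : ℝ) (p : Fin (d + 1) → ℤ) (S : Finset (Fin (d + 1)))
    (i : Fin (d + 1)) (hi : i ∉ S) :
    vtx d a p (insert i S) - vtx d a p S = a • EuclideanSpace.single i (1 : ℝ) := by
  ext j
  by_cases hj : j = i
  · subst hj; simp [vtx_apply, hi]
  · simp [vtx_apply, hj]

lemma IsPLGrid.exists_affine {d : ℕ} {a : ℝ} {h : Eucl d → ℝ} (hh : IsPLGrid d a h) (ha : 0 < a)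
    {p : Fin (d + 1) → ℤ} {z : Eucl d} (hz : InCell d a p z) :
    ∃ φ : Eucl d →ᵃ[ℝ] ℝ, h =ᶠ[𝓝 z] φ ∧ h (vtx d a p ∅) = φ (vtx d a p ∅) ∧
      ∀ i, edgeInc d a p h z i = a * φ.linear (EuclideanSpace.single i (1 : ℝ)) := by
  set t : Fin (d + 1) → ℝ := fun i => z i - a * p i with ht
  set s : Equiv.Perm (Fin (d + 1)) := Tuple.sort fun i => - t i with hs
  have hanti : ∀ k l, k ≤ l → t (s l) ≤ t (s k) := by
    intro k l hkl
    have := Tuple.monotone_sort (fun i => - t i) hkl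
    simp only [Function.comp] at this
    linarith
  have hstrict : ∀ k l, k < l → t (s l) < t (s k) := by
    intro k l hkl
    refine lt_of_le_of_ne (hanti k l hkl.le) fun e => ?_
    exact hkl.ne' (s.injective (hz.inj _ _ e))
  obtain ⟨φ, hφ⟩ := hh.2 p s
  have hvtx : ∀ S : Finset (Fin (d + 1)), (∀ j k, j ∈ S → t j ≤ t k → k ∈ S) →
      h (vtx d a p S) = φ (vtx d a p S) := by
    intro S hS
    refine hφ _ ?_ ?_
    · intro i
      rw [vtx_apply]
      split_ifs <;> constructor <;> linarith
    · intro k l hkl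
      rw [vtx_apply, vtx_apply]
      have := hS (s l) (s k)
      have h2 := hanti k l hkl
      by_cases h1 : s l ∈ S
      · simp [h1, this h1 h2]
      · simp only [h1, if_false]; split_ifs <;> linarith
  refine ⟨φ, ?_, hvtx _ (by simp), ?_⟩
  · have hc : ∀ (i : Fin (d + 1)) (c : ℝ), Continuous fun y : Eucl d => y i - c :=
      fun i c => by fun_prop
    have e1 : ∀ᶠ y in 𝓝 z, ∀ i, 0 < y i - a * p i := by
      rw [eventually_all]
      intro i
      exact (hc i _).continuousAt.eventually (lt_mem_nhds (hz.pos i))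
    have e2 : ∀ᶠ y in 𝓝 z, ∀ i, y i - a * p i < a := by
      rw [eventually_all]
      intro i
      exact (hc i _).continuousAt.eventually (gt_mem_nhds (hz.lt i))
    have e3 : ∀ᶠ y in 𝓝 z, ∀ k l, k < l →
        y (s l) - a * p (s l) < y (s k) - a * p (s k) := by
      simp only [eventually_all]
      intro k l hkl
      exact ContinuousAt.eventually_lt (hc _ _).continuousAt (hc _ _).continuousAt
        (hstrict k l hkl)
    filter_upwards [e1, e2, e3] with y h1 h2 h3
    refine hφ y (fun i => ⟨by linarith [h1 i], by linarith [h2 i]⟩) fun k l hkl => ?_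
    rcases hkl.eq_or_lt with rfl | hkl
    · exact le_rfl
    · exact (h3 k l hkl).le
  · intro i
    have hi : i ∉ dirsAbove d a p z i := by simp [mem_dirsAbove]
    rw [edgeInc, hvtx, hvtx]
    · rw [← vsub_eq_sub (φ _), ← φ.linearMap_vsub, vsub_eq_sub, vtx_insert_sub _ _ _ _ _ hi]
      simp
    · intro j k hj hjk
      rw [mem_dirsAbove] at *
      exact lt_of_lt_of_le hj hjk
    · intro j k hj hjk
      rw [Finset.mem_insert, mem_dirsAbove] at *
      rcases hj with rfl | hj
      · rcases hjk.eq_or_lt with e | e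
        · exact Or.inl (hz.inj _ _ e).symm
        · exact Or.inr e
      · exact Or.inr (lt_of_lt_of_le hj hjk)

lemma IsPLGrid.differentiableAt {d : ℕ} {a : ℝ} {h : Eucl d → ℝ} (hh : IsPLGrid d a h)
    (ha : 0 < a) {p : Fin (d + 1) → ℤ} {z : Eucl d} (hz : InCell d a p z) :
    DifferentiableAt ℝ h z := by
  obtain ⟨φ, h1, -, -⟩ := hh.exists_affine ha hz
  have := (⟨φ, φ.continuous_of_finiteDimensional⟩ : Eucl d →ᴬ[ℝ] ℝ).hasFDerivAt (x := z)
  exact (this.congr_of_eventuallyEq h1).differentiableAt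

lemma IsPLGrid.fderiv_single {d : ℕ} {a : ℝ} {h : Eucl d → ℝ} (hh : IsPLGrid d a h)
    (ha : 0 < a) {p : Fin (d + 1) → ℤ} {z : Eucl d} (hz : InCell d a p z) (i : Fin (d + 1)) :
    fderiv ℝ h z (EuclideanSpace.single i (1 : ℝ)) = edgeInc d a p h z i / a := by
  obtain ⟨φ, h1, -, h3⟩ := hh.exists_affine ha hz
  have := (⟨φ, φ.continuous_of_finiteDimensional⟩ : Eucl d →ᴬ[ℝ] ℝ).hasFDerivAt (x := z)
  rw [(this.congr_of_eventuallyEq h1).fderiv, h3 i, mul_div_cancel_left₀ _ ha.ne']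
  rfl

lemma IsPLGrid.eq_sum {d : ℕ} {a : ℝ} {h : Eucl d → ℝ} (hh : IsPLGrid d a h)
    (ha : 0 < a) {p : Fin (d + 1) → ℤ} {z : Eucl d} (hz : InCell d a p z) :
    h z = h (vtx d a p ∅) + ∑ i, (z i - a * p i) / a * edgeInc d a p h z i := by
  obtain ⟨φ, h1, h2, h3⟩ := hh.exists_affine ha hz
  have e : z - vtx d a p ∅ = ∑ i, (z i - a * p i) • EuclideanSpace.single i (1 : ℝ) := by
    ext j
    simp [vtx_apply, Finset.sum_apply, Pi.single_apply]
  have e2 : φ z - φ (vtx d a p ∅) = φ.linear (z - vtx d a p ∅) := by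
    rw [← vsub_eq_sub (φ _), ← φ.linearMap_vsub, vsub_eq_sub]
  rw [h1.eq_of_nhds, h2, ← sub_eq_iff_eq_add', e2, e, map_sum]
  refine Finset.sum_congr rfl fun i _ => ?_
  rw [h3 i, map_smul, smul_eq_mul]
  field_simp

lemma norm_sq_le_sum_single {d : ℕ} (A : Eucl d →L[ℝ] ℝ) :
    ‖A‖ ^ 2 ≤ ∑ i, (A (EuclideanSpace.single i (1 : ℝ))) ^ 2 := by
  have hs : 0 ≤ ∑ i, (A (EuclideanSpace.single i (1 : ℝ))) ^ 2 :=
    Finset.sum_nonneg fun i _ => sq_nonneg _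
  have : ‖A‖ ≤ √(∑ i, (A (EuclideanSpace.single i (1 : ℝ))) ^ 2) := by
    refine A.opNorm_le_bound (Real.sqrt_nonneg _) fun x => ?_
    have hx : x = ∑ i, x i • EuclideanSpace.single i (1 : ℝ) := by
      ext j; simp [Finset.sum_apply, Pi.single_apply]
    have hA : A x = ∑ i, A (EuclideanSpace.single i (1 : ℝ)) * x i := by
      conv_lhs => rw [hx]
      rw [map_sum]
      exact Finset.sum_congr rfl fun i _ => by rw [map_smul, smul_eq_mul, mul_comm]
    rw [EuclideanSpace.norm_eq, hA, ← Real.sqrt_mul hs, Real.norm_eq_abs]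
    refine Real.abs_le_sqrt ?_
    simpa using Finset.sum_mul_sq_le_sq_mul_sq Finset.univ
      (fun i => A (EuclideanSpace.single i (1 : ℝ))) (fun i => x i)
  calc ‖A‖ ^ 2 ≤ _ := pow_le_pow_left₀ (norm_nonneg _) this 2
    _ = _ := Real.sq_sqrt hs

lemma sq_single_le_norm_sq {d : ℕ} (A : Eucl d →L[ℝ] ℝ) (i : Fin (d + 1)) :
    (A (EuclideanSpace.single i (1 : ℝ))) ^ 2 ≤ ‖A‖ ^ 2 := by
  have := A.le_opNorm (EuclideanSpace.single i (1 : ℝ))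
  simp only [PiLp.norm_single, norm_one, mul_one, Real.norm_eq_abs] at this
  exact sq_le_sq' (by linarith [neg_abs_le (A (EuclideanSpace.single i (1 : ℝ)))])
    ((le_abs_self _).trans this)

lemma ae_linear_ne {d : ℕ} (l : Eucl d →ₗ[ℝ] ℝ) (hl : l ≠ 0) (c : ℝ) :
    ∀ᵐ z : Eucl d, l z ≠ c := by
  rw [ae_iff]
  simp only [not_not]
  by_cases hne : ∃ z0, l z0 = c
  · obtain ⟨z0, h0⟩ := hne
    refine measure_mono_null (t := (AffineSubspace.mk' z0 (LinearMap.ker l) : Set (Eucl d))) ?_ ?_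
    · intro z hz
      simp only [Set.mem_ofPred_eq] at hz
      simp [hz, h0]
    · refine Measure.addHaar_affineSubspace _ _ fun htop => hl ?_
      have := congrArg AffineSubspace.direction htop
      rw [AffineSubspace.direction_mk', AffineSubspace.direction_top] at this
      exact LinearMap.ker_eq_top.mp this
  · push Not at hne
    simp [hne]

lemma ae_inCell (d : ℕ) {a : ℝ} (ha : 0 < a) :
    ∀ᵐ z : Eucl d, InCell d a (fun i => ⌊z i / a⌋) z := by
  let l : Fin (d + 1) → Eucl d →ₗ[ℝ] ℝ := fun i => (EuclideanSpace.proj i : Eucl d →L[ℝ] ℝ)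
  have hl : ∀ i z, l i z = z i := fun i z => rfl
  have h1 : ∀ᵐ z : Eucl d, ∀ (i : Fin (d + 1)) (k : ℤ), z i ≠ a * k := by
    simp only [ae_all_iff]
    intro i k
    refine ae_linear_ne (l i) (fun h => ?_) _
    have := congrArg (fun f => f (EuclideanSpace.single i (1 : ℝ))) h
    simp [hl] at this
  have h2 : ∀ᵐ z : Eucl d, ∀ (i j : Fin (d + 1)) (k : ℤ), i ≠ j → z i - z j ≠ a * k := by
    simp only [ae_all_iff]
    intro i j k hij
    refine ae_linear_ne (l i - l j) (fun h => ?_) _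
    have := congrArg (fun f => f (EuclideanSpace.single i (1 : ℝ))) h
    simp [hl, hij.symm] at this
  filter_upwards [h1, h2] with z hz1 hz2
  refine ⟨fun i => ?_, fun i => ?_, fun i j hij => ?_⟩
  · have := Int.floor_le (z i / a)
    rw [le_div_iff₀ ha] at this
    have h3 := hz1 i ⌊z i / a⌋
    rcases this.lt_or_eq with h | h
    · linarith
    · exact absurd (by linarith) h3
  · have := Int.lt_floor_add_one (z i / a)
    rw [div_lt_iff₀ ha] at this
    linarith
  · by_contra hne
    refine hz2 i j (⌊z i / a⌋ - ⌊z j / a⌋) hne ?_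
    push_cast
    linarith

lemma IsPLGrid.add {d : ℕ} {a : ℝ} {h k : Eucl d → ℝ} (hh : IsPLGrid d a h)
    (hk : IsPLGrid d a k) : IsPLGrid d a fun z => h z + k z := by
  refine ⟨hh.1.add hk.1, fun p s => ?_⟩
  obtain ⟨φ, hφ⟩ := hh.2 p s
  obtain ⟨ψ, hψ⟩ := hk.2 p s
  exact ⟨φ + ψ, fun z h1 h2 => by simp [hφ z h1 h2, hψ z h1 h2]⟩

lemma Disc.discFun_pl {d : ℕ} {L a : ℝ} (disc : Disc d L a) (g : gridSet d L a → ℝ) :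
    IsPLGrid d a (discFun d L a disc g) :=
  disc.bc_pl.add (disc.interp0_pl g)

lemma Disc.discFun_grid {d : ℕ} {L a : ℝ} (disc : Disc d L a) (g : gridSet d L a → ℝ)
    (v : Eucl d) (hv : v ∈ gridSet d L a) : discFun d L a disc g v = g ⟨v, hv⟩ := by
  rw [discFun, disc.bc_grid v hv, disc.interp0_grid g v hv, zero_add]

lemma Disc.discFun_pos {d : ℕ} {L a : ℝ} (disc : Disc d L a) (g : gridSet d L a → ℝ)
    (hLa : a ≤ L) (v : Eucl d) (hv : latticePt d a v) (h0 : L - a < v 0) :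
    discFun d L a disc g v = 1 := by
  have hn : v ∉ gridSet d L a := fun h => by linarith [le_abs_self (v 0), h.2.1]
  rw [discFun, disc.bc_lattice_pos v hv hn (by linarith), disc.interp0_lattice g v hv hn, add_zero]

lemma Disc.discFun_neg {d : ℕ} {L a : ℝ} (disc : Disc d L a) (g : gridSet d L a → ℝ)
    (hLa : a ≤ L) (v : Eucl d) (hv : latticePt d a v) (h0 : v 0 < -(L - a)) :
    discFun d L a disc g v = -1 := by
  have hn : v ∉ gridSet d L a := fun h => by linarith [neg_abs_le (v 0), h.2.1]
  rw [discFun, disc.bc_lattice_neg v hv hn (by linarith), disc.interp0_lattice g v hv hn, add_zero]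

lemma Disc.abs_interp0_le {d : ℕ} {L a r : ℝ} (disc : Disc d L a) (e : gridSet d L a → ℝ)
    (hr : 0 ≤ r) (he : ∀ z, |e z| ≤ r) (v : Eucl d) (hv : latticePt d a v) :
    |disc.interp0 e v| ≤ r := by
  by_cases h : v ∈ gridSet d L a
  · rw [disc.interp0_grid e v h]; exact he _
  · rw [disc.interp0_lattice e v hv h]; simpa using hr

lemma Disc.abs_discFun_le {d : ℕ} {L a B : ℝ} (disc : Disc d L a) (g : gridSet d L a → ℝ)
    (hLa : a ≤ L) (hB : 1 ≤ B) (hg : ∀ z, |g z| ≤ B) (v : Eucl d) (hv : latticePt d a v)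
    (hcyl : ∀ i : Fin d, v i.succ ∈ Set.Icc (0 : ℝ) 1) :
    |discFun d L a disc g v| ≤ B := by
  rcases le_or_gt |v 0| (L - a) with h | h
  · rw [disc.discFun_grid g v ⟨hv, h, hcyl⟩]; exact hg _
  · rcases lt_abs.1 h with h | h
    · rw [disc.discFun_pos g hLa v hv h]; simpa using hB
    · rw [disc.discFun_neg g hLa v hv (by linarith)]; simpa using hB

lemma vtx_floor_mem_Icc {d n : ℕ} (hn : 0 < n) {a : ℝ} (ha : a = 1 / n) {z : Eucl d}
    (hz : ∀ i : Fin d, z i.succ ∈ Set.Ioo (0 : ℝ) 1) (S : Finset (Fin (d + 1))) (i : Fin d) :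
    vtx d a (fun i => ⌊z i / a⌋) S i.succ ∈ Set.Icc (0 : ℝ) 1 := by
  have hn' : (0 : ℝ) < n := by exact_mod_cast hn
  have ha0 : 0 < a := by rw [ha]; positivity
  have han : a * n = 1 := by rw [ha]; field_simp
  have h0 : 0 ≤ ⌊z i.succ / a⌋ := Int.floor_nonneg.2 (div_nonneg (hz i).1.le ha0.le)
  have h1 : ⌊z i.succ / a⌋ < n := by
    rw [Int.floor_lt, div_lt_iff₀ ha0]
    push_cast
    linarith [(hz i).2]
  have h0' : (0 : ℝ) ≤ (⌊z i.succ / a⌋ : ℤ) := by exact_mod_cast h0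
  have h1' : ((⌊z i.succ / a⌋ : ℤ) : ℝ) + 1 ≤ n := by exact_mod_cast h1
  have h2 : a * ((⌊z i.succ / a⌋ : ℤ) + 1 : ℝ) ≤ a * n := mul_le_mul_of_nonneg_left h1' ha0.le
  have h3 : 0 ≤ a * ((⌊z i.succ / a⌋ : ℤ) : ℝ) := mul_nonneg ha0.le h0'
  rw [vtx_apply]
  split_ifs <;> constructor <;> nlinarith

lemma measurableSet_domDL (d : ℕ) (L : ℝ) : MeasurableSet (domDL d L) := by
  have : domDL d L = {z : Eucl d | |z 0| < L} ∩ ⋂ i : Fin d, {z : Eucl d | 0 < z i.succ ∧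
      z i.succ < 1} := by
    ext z; simp [domDL]
  rw [this]
  refine MeasurableSet.inter (measurableSet_lt (by fun_prop) measurable_const)
    (MeasurableSet.iInter fun i => ?_)
  exact measurableSet_Ioo.preimage (f := fun z : Eucl d => z i.succ) (by fun_prop)

lemma measurePreserving_coord_domDL (d : ℕ) (L : ℝ) :
    MeasurePreserving (fun z : Eucl d => z 0) (volume.restrict (domDL d L))
      (volume.restrict (Set.Ioo (-L) L)) := by
  let s : Fin (d + 1) → Set ℝ := Fin.cons (Set.Ioo (-L) L) fun _ => Set.Ioo 0 1
  have hpre : domDL d L = (MeasurableEquiv.toLp 2 (Fin (d + 1) → ℝ)).symm ⁻¹' (Set.univ.pi s) := by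
    ext z
    simp [domDL, s, Set.mem_pi, Fin.forall_fin_succ, abs_lt]
  have hs : MeasurableSet (Set.univ.pi s) := by
    refine MeasurableSet.univ_pi fun i => ?_
    refine Fin.cases ?_ (fun j => ?_) i <;> simp [s]
  have h1 := (EuclideanSpace.volume_preserving_symm_measurableEquiv_toLp
    (Fin (d + 1))).restrict_preimage hs
  have h2 : MeasurePreserving (Function.eval (0 : Fin (d + 1)) : (Fin (d + 1) → ℝ) → ℝ)
      ((volume : Measure (Fin (d + 1) → ℝ)).restrict (Set.univ.pi s))
      (volume.restrict (Set.Ioo (-L) L)) := by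
    refine ⟨measurable_pi_apply _, ?_⟩
    rw [volume_pi, Measure.restrict_pi_pi, Measure.pi_map_eval]
    have : ∏ j ∈ Finset.univ.erase (0 : Fin (d + 1)),
        ((volume : Measure ℝ).restrict (s j)) Set.univ = 1 := by
      refine Finset.prod_eq_one fun j hj => ?_
      obtain ⟨k, rfl⟩ := Fin.exists_succ_eq.2 (Finset.ne_of_mem_erase hj)
      simp [s]
    rw [this, one_smul]
    rfl
  rw [hpre]
  exact h2.comp h1

lemma integrableOn_domDL_comp {d : ℕ} {L : ℝ} {G : ℝ → ℝ}
    (hG : IntegrableOn G (Set.Ioo (-L) L)) :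
    IntegrableOn (fun z : Eucl d => G (z 0)) (domDL d L) :=
  (measurePreserving_coord_domDL d L).integrable_comp_of_integrable hG

lemma integral_domDL_comp {d : ℕ} {L : ℝ} {G : ℝ → ℝ}
    (hG : IntegrableOn G (Set.Ioo (-L) L)) :
    ∫ z in domDL d L, G ((z : Eucl d) 0) = ∫ s in Set.Ioo (-L) L, G s := by
  have h := measurePreserving_coord_domDL d L
  have hG' : AEStronglyMeasurable G
      (Measure.map (fun z : Eucl d => z 0) (volume.restrict (domDL d L))) := by
    rw [h.map_eq]; exact hG.aestronglyMeasurable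
  rw [← h.map_eq, integral_map h.measurable.aemeasurable hG']

lemma volume_domDL_lt_top (d : ℕ) (L : ℝ) : volume (domDL d L) < ⊤ := by
  have h := measurePreserving_coord_domDL d L
  have := h.measure_preimage MeasurableSet.univ.nullMeasurableSet
  simp only [Set.preimage_univ, Measure.restrict_apply_univ, Real.volume_Ioo] at this
  rw [this]; exact ENNReal.ofReal_lt_top

lemma volume_box (d : ℕ) (lo : Fin (d + 1) → ℝ) (w : ℝ) :
    volume {z : Eucl d | ∀ i, z i ∈ Set.Ioo (lo i) (lo i + w)} = ENNReal.ofReal w ^ (d + 1) := by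
  have hpre : {z : Eucl d | ∀ i, z i ∈ Set.Ioo (lo i) (lo i + w)} =
      (MeasurableEquiv.toLp 2 (Fin (d + 1) → ℝ)).symm ⁻¹'
        (Set.univ.pi fun i => Set.Ioo (lo i) (lo i + w)) := by
    ext z
    simp [Set.mem_pi]
  rw [hpre, (EuclideanSpace.volume_preserving_symm_measurableEquiv_toLp
    (Fin (d + 1))).measure_preimage (MeasurableSet.univ_pi fun i =>
      measurableSet_Ioo).nullMeasurableSet, Real.volume_pi_Ioo]
  simp

lemma IsPLGrid.ae_norm_fderiv_sq_le {d : ℕ} {a : ℝ} {h : Eucl d → ℝ} (hh : IsPLGrid d a h)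
    (ha : 0 < a) : ∀ᵐ z : Eucl d, ‖fderiv ℝ h z‖ ^ 2 ≤
      ∑ i, (edgeInc d a (fun i => ⌊z i / a⌋) h z i / a) ^ 2 := by
  filter_upwards [ae_inCell d ha] with z hz
  refine (norm_sq_le_sum_single _).trans_eq (Finset.sum_congr rfl fun i _ => ?_)
  rw [hh.fderiv_single ha hz]

lemma Disc.integrableOn_grad_sq {d n : ℕ} (hn : 0 < n) {L a : ℝ} (ha : a = 1 / n) (hLa : a ≤ L)
    (disc : Disc d L a) (g : gridSet d L a → ℝ) :
    IntegrableOn (fun z => ‖fderiv ℝ (discFun d L a disc g) z‖ ^ 2) (domDL d L) := by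
  let := disc.gridFin
  have ha0 : 0 < a := by rw [ha]; positivity
  set B : ℝ := 1 + ∑ z, |g z| with hB
  have hB1 : 1 ≤ B := by
    have : 0 ≤ ∑ z, |g z| := Finset.sum_nonneg fun _ _ => abs_nonneg _
    linarith
  have hg : ∀ z, |g z| ≤ B := fun z => by
    have := Finset.single_le_sum (f := fun z => |g z|) (fun _ _ => abs_nonneg _)
      (Finset.mem_univ z)
    linarith
  refine Measure.integrableOn_of_bounded (volume_domDL_lt_top d L).ne
    ((measurable_fderiv ℝ _).norm.pow_const 2).aestronglyMeasurable
    (M := ∑ _i : Fin (d + 1), (2 * B / a) ^ 2) ?_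
  filter_upwards [ae_restrict_mem (measurableSet_domDL d L),
    ae_restrict_of_ae ((disc.discFun_pl g).ae_norm_fderiv_sq_le ha0)] with z hz h1
  rw [Real.norm_of_nonneg (by positivity)]
  refine h1.trans (Finset.sum_le_sum fun i _ => ?_)
  have hb := fun S => disc.abs_discFun_le g hLa hB1 hg (vtx d a (fun i => ⌊z i / a⌋) S)
    (vtx_latticePt _ _ _ _) (vtx_floor_mem_Icc hn ha hz.2 S)
  rw [div_pow, div_pow]
  gcongr ?_ / _
  refine sq_le_sq' ?_ ?_ <;> rw [edgeInc]
  · linarith [abs_le.1 (hb (insert i (dirsAbove d a (fun i => ⌊z i / a⌋) z i))),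
      abs_le.1 (hb (dirsAbove d a (fun i => ⌊z i / a⌋) z i))]
  · linarith [abs_le.1 (hb (insert i (dirsAbove d a (fun i => ⌊z i / a⌋) z i))),
      abs_le.1 (hb (dirsAbove d a (fun i => ⌊z i / a⌋) z i))]

lemma IsPLGrid.edge_sq_le {d n : ℕ} (hn : 0 < n) {L a : ℝ} (ha : a = 1 / n) {h : Eucl d → ℝ}
    (hh : IsPLGrid d a h) (hfint : IntegrableOn (fun z => ‖fderiv ℝ h z‖ ^ 2) (domDL d L))
    (q : Fin (d + 1) → ℤ) (hq : ∀ i : Fin d, 0 ≤ q i.succ ∧ q i.succ ≤ n)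
    (hq0 : -L ≤ a * q 0) (hq1 : a * (q 0 + 1) ≤ L) :
    (h (vtx d a q {0}) - h (vtx d a q ∅)) ^ 2 ≤ a ^ 2 * (3 / a) ^ (d + 1) * dirEnergy d L h := by
  have hn' : (0 : ℝ) < n := by exact_mod_cast hn
  have hn1 : (1 : ℝ) ≤ n := by exact_mod_cast hn
  have ha0 : 0 < a := by rw [ha]; positivity
  have han : a * n = 1 := by rw [ha]; field_simp
  let lo : Fin (d + 1) → ℝ := Fin.cons (a * q 0 + a / 3) fun i =>
    if q i.succ = n then a * q i.succ - a / 3 else a * q i.succ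
  set S : Set (Eucl d) := {z : Eucl d | ∀ i, z i ∈ Set.Ioo (lo i) (lo i + a / 3)} with hS
  have hlo0 : lo 0 = a * q 0 + a / 3 := rfl
  have hlos : ∀ i : Fin d, lo i.succ =
    if q i.succ = n then a * q i.succ - a / 3 else a * q i.succ := fun i => rfl
  have hSm : MeasurableSet S := by
    have : S = ⋂ i, (fun z : Eucl d => z i) ⁻¹' Set.Ioo (lo i) (lo i + a / 3) := by
      ext z; simp [hS]
    rw [this]
    exact MeasurableSet.iInter fun i => measurableSet_Ioo.preimage (by fun_prop)
  have hSD : S ⊆ domDL d L := by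
    intro z hz
    refine ⟨?_, fun i => ?_⟩
    · have := hz 0
      rw [hlo0] at this
      rw [abs_lt]
      constructor <;> nlinarith [this.1, this.2]
    · have h1 := hz i.succ
      rw [hlos] at h1
      have h2 : (0 : ℝ) ≤ q i.succ := by exact_mod_cast (hq i).1
      have h3 : 0 ≤ a * (q i.succ : ℝ) := mul_nonneg ha0.le h2
      split_ifs at h1 with h
      · have h4 : (q i.succ : ℝ) = n := by exact_mod_cast h
        rw [h4, han] at h1
        have : a ≤ 1 := by nlinarith
        constructor <;> linarith [h1.1, h1.2]
      · have h4 : (q i.succ : ℝ) + 1 ≤ n := by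
          have := lt_of_le_of_ne (hq i).2 h
          exact_mod_cast this
        have h5 : a * ((q i.succ : ℝ) + 1) ≤ a * n := mul_le_mul_of_nonneg_left h4 ha0.le
        constructor <;> nlinarith [h1.1, h1.2]
  set Δ := h (vtx d a q {0}) - h (vtx d a q ∅) with hΔ
  have hpt : ∀ᵐ z : Eucl d, z ∈ S → (Δ / a) ^ 2 ≤ ‖fderiv ℝ h z‖ ^ 2 := by
    filter_upwards [ae_inCell d ha0] with z hz hzS
    have hp0 : ⌊z 0 / a⌋ = q 0 := by
      have := hzS 0
      rw [hlo0] at this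
      rw [Int.floor_eq_iff, le_div_iff₀ ha0, div_lt_iff₀ ha0]
      constructor <;> nlinarith [this.1, this.2]
    have hps : ∀ i : Fin d, ⌊z i.succ / a⌋ = if q i.succ = n then q i.succ - 1 else q i.succ := by
      intro i
      have h1 := hzS i.succ
      rw [hlos] at h1
      rw [Int.floor_eq_iff, le_div_iff₀ ha0, div_lt_iff₀ ha0]
      split_ifs at h1 ⊢ with h
      · push_cast
        constructor <;> nlinarith [h1.1, h1.2]
      · constructor <;> nlinarith [h1.1, h1.2]
    have hmem : ∀ i : Fin d, i.succ ∈ dirsAbove d a (fun i => ⌊z i / a⌋) z 0 ↔ q i.succ = n := by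
      intro i
      rw [mem_dirsAbove]
      have h1 := hzS i.succ
      have h0 := hzS 0
      rw [hlos] at h1
      rw [hlo0] at h0
      simp only [hp0, hps i]
      split_ifs at h1 ⊢ with h
      · push_cast
        simp only [h, iff_true]
        rw [h] at h1
        rw [Int.cast_natCast] at h1 ⊢
        nlinarith [h1.1, h1.2, h0.1, h0.2]
      · simp only [h, iff_false, not_lt]
        nlinarith [h1.1, h1.2, h0.1, h0.2]
    have hnot : (0 : Fin (d + 1)) ∉ dirsAbove d a (fun i => ⌊z i / a⌋) z 0 := by
      simp [mem_dirsAbove]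
    have e1 : vtx d a (fun i => ⌊z i / a⌋) (dirsAbove d a (fun i => ⌊z i / a⌋) z 0) =
        vtx d a q ∅ := by
      ext j
      refine Fin.cases ?_ (fun i => ?_) j
      · simp [vtx_apply, hnot, hp0]
      · simp only [vtx_apply, hmem, hps, Finset.notMem_empty, if_false]
        split_ifs <;> push_cast <;> ring
    have e2 : vtx d a (fun i => ⌊z i / a⌋) (insert 0 (dirsAbove d a (fun i => ⌊z i / a⌋) z 0)) =
        vtx d a q {0} := by
      ext j
      refine Fin.cases ?_ (fun i => ?_) j
      · simp [vtx_apply, hp0]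
      · simp only [vtx_apply, Finset.mem_insert, Finset.mem_singleton, hmem, hps,
          Fin.succ_ne_zero, false_or, if_false]
        split_ifs <;> push_cast <;> ring
    have := sq_single_le_norm_sq (fderiv ℝ h z) 0
    rwa [hh.fderiv_single ha0 hz, edgeInc, e1, e2] at this
  have hfin : volume S ≠ ⊤ := ne_top_of_le_ne_top (volume_domDL_lt_top d L).ne (measure_mono hSD)
  have hI : ∫ _z in S, (Δ / a) ^ 2 ≤ dirEnergy d L h := by
    calc ∫ _z in S, (Δ / a) ^ 2 ≤ ∫ z in S, ‖fderiv ℝ h z‖ ^ 2 := by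
          refine integral_mono_ae (integrableOn_const hfin) (hfint.mono_set hSD) ?_
          exact (ae_restrict_iff' hSm).2 hpt
      _ ≤ _ := setIntegral_mono_set hfint (Eventually.of_forall fun z => by positivity)
          (LE.le.eventuallyLE hSD)
  have hvol : volume.real S = (a / 3) ^ (d + 1) := by
    rw [Measure.real, hS, volume_box, ENNReal.toReal_pow, ENNReal.toReal_ofReal (by positivity)]
  rw [setIntegral_const, hvol, smul_eq_mul] at hI
  have h3 : (3 / a) ^ (d + 1) * (a / 3) ^ (d + 1) = 1 := by
    rw [← mul_pow, div_mul_div_comm, mul_comm, div_self (by positivity), one_pow]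
  calc Δ ^ 2 = a ^ 2 * (3 / a) ^ (d + 1) * ((a / 3) ^ (d + 1) * (Δ / a) ^ 2) := by
        rw [div_pow Δ]
        calc Δ ^ 2 = ((3 / a) ^ (d + 1) * (a / 3) ^ (d + 1)) * (a ^ 2 * (Δ ^ 2 / a ^ 2)) := by
              rw [h3]; field_simp
          _ = _ := by ring
    _ ≤ _ := by gcongr

lemma Disc.coercive {d n : ℕ} (hn : 0 < n) {L a : ℝ} (ha : a = 1 / n) (hLa : a ≤ L)
    (disc : Disc d L a) (g : gridSet d L a → ℝ) (z : gridSet d L a) :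
    (g z - 1) ^ 2 ≤ 4 * L ^ 2 * (3 / a) ^ (d + 1) * dirEnergy d L (discFun d L a disc g) := by
  have ha0 : 0 < a := by rw [ha]; positivity
  have hn' : (0 : ℝ) < n := by exact_mod_cast hn
  have han : a * n = 1 := by rw [ha]; field_simp
  set h := discFun d L a disc g with hh
  set f := dirEnergy d L h with hf
  have hf0 : 0 ≤ f := integral_nonneg fun _ => by positivity
  choose q hq using z.2.1
  have hqc : ∀ i : Fin d, 0 ≤ q i.succ ∧ q i.succ ≤ n := by
    intro i
    have h1 := z.2.2.2 i
    rw [hq] at h1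
    constructor
    · by_contra hc
      have : (q i.succ : ℝ) < 0 := by exact_mod_cast not_le.1 hc
      nlinarith [h1.1]
    · by_contra hc
      have : (n : ℝ) < q i.succ := by exact_mod_cast not_le.1 hc
      nlinarith [h1.2]
  have hz0 : |a * q 0| ≤ L - a := by rw [← hq 0]; exact z.2.2.1
  rw [abs_le] at hz0
  have hfl : q 0 ≤ ⌊(L - a) / a⌋ := by
    rw [Int.le_floor, le_div_iff₀ ha0]; linarith
  obtain ⟨K, hK⟩ := Int.eq_ofNat_of_zero_le (a := ⌊(L - a) / a⌋ - q 0 + 1) (by linarith)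
  have hKle : a * ((q 0 : ℝ) + K) ≤ L := by
    have h1 := Int.floor_le ((L - a) / a)
    rw [le_div_iff₀ ha0] at h1
    have h2 : ((⌊(L - a) / a⌋ : ℤ) : ℝ) - q 0 + 1 = K := by exact_mod_cast hK
    rw [← h2]; nlinarith
  have hKlt : L - a < a * ((q 0 : ℝ) + K) := by
    have h1 := Int.lt_floor_add_one ((L - a) / a)
    rw [div_lt_iff₀ ha0] at h1
    have h2 : ((⌊(L - a) / a⌋ : ℤ) : ℝ) - q 0 + 1 = K := by exact_mod_cast hK
    rw [← h2]; nlinarith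
  let Q : ℕ → Fin (d + 1) → ℤ := fun k => Function.update q 0 (q 0 + k)
  have hQ0 : ∀ k, Q k 0 = q 0 + k := fun k => by simp [Q]
  have hQs : ∀ k (i : Fin d), Q k i.succ = q i.succ := fun k i => by simp [Q]
  set δ := √(a ^ 2 * (3 / a) ^ (d + 1) * f) with hδ
  have hstep : ∀ k < K, |h (vtx d a (Q (k + 1)) ∅) - h (vtx d a (Q k) ∅)| ≤ δ := by
    intro k hk
    have e : vtx d a (Q (k + 1)) ∅ = vtx d a (Q k) {0} := by
      ext j
      refine Fin.cases ?_ (fun i => ?_) j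
      · simp [vtx_apply, hQ0]; ring
      · simp [vtx_apply, hQs]
    rw [e]
    have hkK : (k : ℝ) + 1 ≤ K := by exact_mod_cast hk
    refine Real.abs_le_sqrt ((disc.discFun_pl g).edge_sq_le hn ha
      (disc.integrableOn_grad_sq hn ha hLa g) (Q k) (fun i => ?_) ?_ ?_)
    · rw [hQs]; exact hqc i
    · rw [hQ0]; push_cast
      have : 0 ≤ a * (k : ℝ) := by positivity
      linarith
    · rw [hQ0]; push_cast
      nlinarith
  have hchain : ∀ k ≤ K, |h (vtx d a (Q k) ∅) - h (vtx d a (Q 0) ∅)| ≤ k * δ := by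
    intro k
    induction k with
    | zero => simp
    | succ k ih =>
      intro hk
      have h1 := ih (by omega)
      have h2 := hstep k (by omega)
      have := abs_add_le (h (vtx d a (Q (k + 1)) ∅) - h (vtx d a (Q k) ∅))
        (h (vtx d a (Q k) ∅) - h (vtx d a (Q 0) ∅))
      rw [sub_add_sub_cancel] at this
      push_cast
      linarith
  have hend : h (vtx d a (Q K) ∅) = 1 := by
    refine disc.discFun_pos g hLa _ (vtx_latticePt _ _ _ _) ?_
    simp only [vtx_apply, hQ0]
    push_cast
    simpa using hKlt
  have hstart : h (vtx d a (Q 0) ∅) = g z := by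
    have : vtx d a (Q 0) ∅ = z.1 := by
      ext j
      rw [hq]
      simp [vtx_apply, Q]
    rw [this]
    exact disc.discFun_grid g _ z.2
  have hfinal := hchain K le_rfl
  rw [hend, hstart, abs_sub_comm] at hfinal
  have hKL : (K : ℝ) * a ≤ 2 * L := by linarith
  calc (g z - 1) ^ 2 = |g z - 1| ^ 2 := (sq_abs _).symm
    _ ≤ (K * δ) ^ 2 := by gcongr
    _ = (K * a) ^ 2 * ((3 / a) ^ (d + 1) * f) := by
        rw [mul_pow, hδ, Real.sq_sqrt (by positivity)]; ring
    _ ≤ (2 * L) ^ 2 * ((3 / a) ^ (d + 1) * f) := by gcongr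
    _ = _ := by ring

lemma IsStdPotential.antitoneOn {F : ℝ → ℝ} (hF : IsStdPotential F) :
    AntitoneOn F (Set.Icc 0 1) := by
  have hd : Differentiable ℝ F := hF.smooth.differentiable (by norm_num)
  have hinj : Set.InjOn F (Set.Icc 0 1) := by
    have key : ∀ x ∈ Set.Icc (0 : ℝ) 1, ∀ y ∈ Set.Icc (0 : ℝ) 1, x < y → F x ≠ F y := by
      intro x hx y hy hxy he
      obtain ⟨c, hc, hc0⟩ := exists_deriv_eq_zero hxy hd.continuous.continuousOn he
      rcases (hF.deriv_zero_iff c).1 hc0 with h | h | h <;>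
        linarith [hc.1, hc.2, hx.1, hx.2, hy.1, hy.2]
    intro x hx y hy he
    rcases lt_trichotomy x y with h | h | h
    · exact absurd he (key x hx y hy h)
    · exact h
    · exact absurd he.symm (key y hy x hx h)
  rcases hd.continuous.continuousOn.strictMonoOn_of_injOn_Icc' zero_le_one hinj with h | h
  · have h1 := h (by simp) (by simp) (zero_lt_one (α := ℝ))
    rw [(hF.zero_iff 1).2 (Or.inl rfl)] at h1
    linarith [hF.nonneg 0]
  · exact h.antitoneOn

lemma IsStdPotential.le_of_abs_le {F : ℝ → ℝ} (hF : IsStdPotential F) {x y : ℝ}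
    (hxy : |x| ≤ |y|) (hy : |y| ≤ 1) : F y ≤ F x := by
  have habs : ∀ t, F |t| = F t := fun t => by
    rcases abs_choice t with h | h <;> rw [h]
    exact hF.symm t
  rw [← habs x, ← habs y]
  exact hF.antitoneOn ⟨abs_nonneg _, hxy.trans hy⟩ ⟨abs_nonneg _, hy⟩ hxy

lemma IsStdPotential.exists_lipschitz {F : ℝ → ℝ} (hF : IsStdPotential F) :
    ∃ C : ℝ, 0 ≤ C ∧ ∀ x ∈ Set.Icc (-2 : ℝ) 2, ∀ y ∈ Set.Icc (-2 : ℝ) 2,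
      |F x - F y| ≤ C * |x - y| := by
  have hc : Continuous (deriv F) := hF.smooth.continuous_deriv (by norm_num)
  obtain ⟨C, hC⟩ := isCompact_Icc.exists_bound_of_continuousOn (s := Set.Icc (-2 : ℝ) 2)
    hc.continuousOn
  refine ⟨C, (norm_nonneg _).trans (hC 0 (by norm_num)), fun x hx y hy => ?_⟩
  exact Convex.norm_image_sub_le_of_norm_deriv_le
    (fun z _ => (hF.smooth.differentiable (by norm_num)) z) hC (convex_Icc _ _) hy hx

lemma IsProfile.monotone {F m : ℝ → ℝ} (hm : IsProfile F m) : Monotone m :=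
  monotone_of_hasDerivAt_nonneg hm.ode fun _ => Real.sqrt_nonneg _

lemma IsProfile.continuous {F m : ℝ → ℝ} (hm : IsProfile F m) : Continuous m :=
  continuous_iff_continuousAt.2 fun x => (hm.ode x).continuousAt

lemma IsProfile.exists_lipschitz {F m : ℝ → ℝ} (hF : Continuous F) (hm : IsProfile F m) :
    ∃ S : ℝ, 0 ≤ S ∧ ∀ x y, |m x - m y| ≤ S * |x - y| := by
  obtain ⟨S, hS⟩ := isCompact_Icc.exists_bound_of_continuousOn (s := Set.Icc (-1 : ℝ) 1)
    (f := fun v => √(2 * F v)) (by fun_prop)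
  refine ⟨S, (norm_nonneg _).trans (hS 0 (by norm_num)), fun x y => ?_⟩
  exact convex_univ.norm_image_sub_le_of_norm_hasDerivWithin_le
    (fun z _ => (hm.ode z).hasDerivWithinAt) (fun z _ => hS (m z) (hm.mem_Icc z))
    (Set.mem_univ y) (Set.mem_univ x)

lemma Cstar_nonneg (F : ℝ → ℝ) : 0 ≤ Cstar F :=
  intervalIntegral.integral_nonneg (by norm_num) fun _ _ => Real.sqrt_nonneg _

/-- Equipartition of energy along the optimal profile. -/
lemma IsProfile.integral_potential_le {F m : ℝ → ℝ} (hF : IsStdPotential F) (hm : IsProfile F m)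
    {T : ℝ} (hT : 0 ≤ T) : ∫ s in Set.Icc (-T) T, F (m s) ≤ Cstar F / 2 := by
  have hFc : Continuous F := hF.smooth.continuous
  have hmc := hm.continuous
  have h1 := intervalIntegral.integral_comp_mul_deriv (a := -T) (b := T) (f := m)
    (f' := fun x => √(2 * F (m x))) (g := fun v => √(2 * F v)) (fun x _ => hm.ode x)
    (by fun_prop) (by fun_prop)
  have h2 : ∀ x, ((fun v => √(2 * F v)) ∘ m) x * √(2 * F (m x)) = 2 * F (m x) := fun x =>
    Real.mul_self_sqrt (mul_nonneg zero_le_two (hF.nonneg _))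
  simp only [h2] at h1
  rw [intervalIntegral.integral_const_mul,
    intervalIntegral.integral_of_le (by linarith)] at h1
  have h3 : ∫ v in m (-T)..m T, √(2 * F v) ≤ Cstar F := by
    refine intervalIntegral.integral_mono_interval (hm.mem_Icc _).1 (hm.monotone (by linarith))
      (hm.mem_Icc _).2 (Eventually.of_forall fun _ => Real.sqrt_nonneg _) ?_
    exact Continuous.intervalIntegrable (by fun_prop) _ _
  rw [integral_Icc_eq_integral_Ioc]
  linarith

/-- The energy density of the profile on the slab `|s| ≤ T`, with an error `e`. -/
def slabDensity (F m : ℝ → ℝ) (T e : ℝ) : ℝ → ℝ :=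
  (Set.Icc (-T) T).indicator fun s => F (m s) + e

lemma slabDensity_integrable {F m : ℝ → ℝ} (hF : IsStdPotential F) (hm : IsProfile F m)
    (T e : ℝ) : Integrable (slabDensity F m T e) := by
  have hFc : Continuous F := hF.smooth.continuous
  have hmc := hm.continuous
  rw [slabDensity, integrable_indicator_iff measurableSet_Icc]
  exact ContinuousOn.integrableOn_Icc (by fun_prop)

lemma slabDensity_nonneg {F m : ℝ → ℝ} (hF : IsStdPotential F) (T : ℝ) {e : ℝ} (he : 0 ≤ e)
    (s : ℝ) : 0 ≤ slabDensity F m T e s :=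
  Set.indicator_nonneg (fun _ _ => add_nonneg (hF.nonneg _) he) s

lemma setIntegral_slabDensity_le {F m : ℝ → ℝ} (hF : IsStdPotential F) (hm : IsProfile F m)
    {T e : ℝ} (hT : 0 ≤ T) (he : 0 ≤ e) (A : Set ℝ) :
    ∫ s in A, slabDensity F m T e s ≤ Cstar F / 2 + 2 * T * e := by
  have hFc : Continuous F := hF.smooth.continuous
  have hmc := hm.continuous
  refine (setIntegral_le_integral (slabDensity_integrable hF hm T e)
    (Eventually.of_forall (slabDensity_nonneg hF T he))).trans ?_
  have hi1 : IntegrableOn (fun s => F (m s)) (Set.Icc (-T) T) :=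
    ContinuousOn.integrableOn_Icc (by fun_prop)
  have hi2 : IntegrableOn (fun _ => e) (Set.Icc (-T) T) := integrableOn_const (by simp)
  rw [slabDensity, integral_indicator measurableSet_Icc, integral_add hi1 hi2]
  refine add_le_add (hm.integral_potential_le hF hT) (le_of_eq ?_)
  rw [setIntegral_const, Real.volume_real_Icc_of_le (by linarith), smul_eq_mul]
  ring

/-- The profile stretched by a factor `1 + δ` and truncated to `[-1,1]`. -/
def truncProfile (m : ℝ → ℝ) (δ x : ℝ) : ℝ := max (-1) (min 1 ((1 + δ) * m x))

lemma truncProfile_mem (m : ℝ → ℝ) (δ x : ℝ) : truncProfile m δ x ∈ Set.Icc (-1 : ℝ) 1 :=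
  ⟨le_max_left _ _, max_le (by norm_num) (min_le_left _ _)⟩

lemma truncProfile_monotone {m : ℝ → ℝ} (hm : Monotone m) {δ : ℝ} (hδ : 0 < δ) :
    Monotone (truncProfile m δ) := fun x y hxy => by
  have := hm hxy
  unfold truncProfile
  gcongr

lemma abs_truncProfile_sub_le {m : ℝ → ℝ} {δ : ℝ} (hδ : 0 < δ) (x y : ℝ) :
    |truncProfile m δ x - truncProfile m δ y| ≤ (1 + δ) * |m x - m y| := by
  refine (abs_max_sub_max_le_max _ _ _ _).trans ?_
  rw [sub_self, abs_zero, max_eq_right (abs_nonneg _)]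
  refine (abs_min_sub_min_le_max _ _ _ _).trans ?_
  rw [sub_self, abs_zero, max_eq_right (abs_nonneg _), ← mul_sub, abs_mul,
    abs_of_pos (by linarith : 0 < 1 + δ)]

lemma IsStdPotential.truncProfile_le {F m : ℝ → ℝ} (hF : IsStdPotential F)
    (hm : IsProfile F m) {δ : ℝ} (hδ : 0 < δ) (x : ℝ) :
    F (truncProfile m δ x) ≤ F (m x) := by
  have hx := hm.mem_Icc x
  refine hF.le_of_abs_le ?_ (abs_le.2 (truncProfile_mem m δ x))
  rcases le_total 0 (m x) with h | h
  · have h1 : m x ≤ truncProfile m δ x :=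
      le_max_of_le_right (le_min hx.2 (by nlinarith))
    rw [abs_of_nonneg h, abs_of_nonneg (h.trans h1)]
    exact h1
  · have h1 : truncProfile m δ x ≤ m x :=
      max_le hx.1 ((min_le_right _ _).trans (by nlinarith))
    rw [abs_of_nonpos h, abs_of_nonpos (h1.trans h)]
    linarith

lemma IsProfile.exists_truncProfile_eq {F m : ℝ → ℝ} (hm : IsProfile F m) {δ : ℝ} (hδ : 0 < δ) :
    ∃ R : ℝ, 0 < R ∧ (∀ x, R ≤ x → truncProfile m δ x = 1) ∧
      ∀ x, x ≤ -R → truncProfile m δ x = -1 := by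
  have hlt : 1 / (1 + δ) < 1 := by rw [div_lt_one (by linarith)]; linarith
  obtain ⟨R1, h1⟩ := eventually_atTop.1 (hm.limit_top.eventually (lt_mem_nhds hlt))
  obtain ⟨R2, h2⟩ := eventually_atBot.1 (hm.limit_bot.eventually
    (gt_mem_nhds (by linarith : -1 < -(1 / (1 + δ)))))
  refine ⟨max 1 (max R1 (-R2)), by positivity, fun x hx => ?_, fun x hx => ?_⟩
  · have h := h1 x ((le_max_left _ _).trans ((le_max_right _ _).trans hx))
    rw [div_lt_iff₀ (by linarith)] at h
    rw [truncProfile, min_eq_left (by linarith)]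
    norm_num
  · have h := h2 x (by linarith [(le_max_right R1 (-R2)).trans (le_max_right 1 _)])
    have h' : (1 + δ) * m x < -1 := by
      have := mul_lt_mul_of_pos_left h (by linarith : 0 < 1 + δ)
      rwa [mul_neg, mul_one_div_cancel (by linarith)] at this
    rw [truncProfile]
    exact max_eq_left ((min_le_right _ _).trans h'.le)

/-- Energy densities of the linear interpolation of the truncated profile on a mesh cell. -/
lemma IsProfile.truncProfile_cell {F m : ℝ → ℝ} (hF : IsStdPotential F) (hm : IsProfile F m)
    {δ : ℝ} (hδ : 0 < δ) :
    ∃ R c : ℝ, 0 < R ∧ 0 ≤ c ∧ (∀ x, R ≤ x → truncProfile m δ x = 1) ∧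
      (∀ x, x ≤ -R → truncProfile m δ x = -1) ∧
      ∀ a, 0 < a → a ≤ 1 → ∀ b s, s ∈ Set.Ioo b (b + a) →
        ((truncProfile m δ (b + a) - truncProfile m δ b) / a) ^ 2 ≤
          2 * (1 + δ) ^ 2 * slabDensity F m (R + 1) (c * a) s ∧
        ∀ θ ∈ Set.Icc (0 : ℝ) 1,
          F (truncProfile m δ b + θ * (truncProfile m δ (b + a) - truncProfile m δ b)) ≤
            slabDensity F m (R + 1) (c * a) s := by
  obtain ⟨R, hR, hR1, hR2⟩ := hm.exists_truncProfile_eq hδ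
  obtain ⟨C, hC, hFL⟩ := hF.exists_lipschitz
  obtain ⟨S, hS, hmL⟩ := hm.exists_lipschitz hF.smooth.continuous
  refine ⟨R, C * ((1 + δ) * S), hR, by positivity, hR1, hR2, fun a ha ha1 b s hs => ?_⟩
  by_cases hsR : s ∈ Set.Icc (-(R + 1)) (R + 1)
  · rw [slabDensity, Set.indicator_of_mem hsR]
    have hmI : ∀ x, m x ∈ Set.Icc (-2 : ℝ) 2 := fun x =>
      ⟨by linarith [(hm.mem_Icc x).1], by linarith [(hm.mem_Icc x).2]⟩
    constructor
    · obtain ⟨ξ, hξ, hslope⟩ := exists_hasDerivAt_eq_slope m (fun x => √(2 * F (m x)))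
        (by linarith : b < b + a) hm.continuous.continuousOn (fun x _ => hm.ode x)
      rw [add_sub_cancel_left] at hslope
      have h1 : ((m (b + a) - m b) / a) ^ 2 = 2 * F (m ξ) := by
        rw [← hslope, Real.sq_sqrt (mul_nonneg zero_le_two (hF.nonneg _))]
      have h2 : F (m ξ) ≤ F (m s) + C * ((1 + δ) * S) * a := by
        have h3 := (le_abs_self _).trans (hFL _ (hmI ξ) _ (hmI s))
        have h4 : |m ξ - m s| ≤ S * a := (hmL ξ s).trans
          (mul_le_mul_of_nonneg_left (abs_le.2 ⟨by linarith [hξ.1, hs.2], by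
            linarith [hξ.2, hs.1]⟩) hS)
        have h5 : C * |m ξ - m s| ≤ C * ((1 + δ) * (S * a)) := by
          refine mul_le_mul_of_nonneg_left (h4.trans ?_) hC
          nlinarith [mul_nonneg hS ha.le]
        linarith
      calc ((truncProfile m δ (b + a) - truncProfile m δ b) / a) ^ 2
          = |truncProfile m δ (b + a) - truncProfile m δ b| ^ 2 / a ^ 2 := by
            rw [div_pow, sq_abs]
        _ ≤ ((1 + δ) * |m (b + a) - m b|) ^ 2 / a ^ 2 := by
            gcongr; exact abs_truncProfile_sub_le hδ _ _
        _ = (1 + δ) ^ 2 * ((m (b + a) - m b) / a) ^ 2 := by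
            rw [mul_pow, sq_abs, div_pow]; ring
        _ = 2 * (1 + δ) ^ 2 * F (m ξ) := by rw [h1]; ring
        _ ≤ _ := by gcongr
    · intro θ hθ
      have hmono := truncProfile_monotone hm.monotone hδ
      have m1 := hmono hs.1.le
      have m2 := hmono hs.2.le
      have hb := truncProfile_mem m δ b
      have hb' := truncProfile_mem m δ (b + a)
      have hss := truncProfile_mem m δ s
      set x := truncProfile m δ b
      set y := truncProfile m δ (b + a)
      have e1 : x ≤ x + θ * (y - x) := by nlinarith [hθ.1]
      have e2 : x + θ * (y - x) ≤ y := by nlinarith [hθ.2]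
      have h3 := (le_abs_self _).trans (hFL (x + θ * (y - x))
        ⟨by linarith [hb.1], by linarith [hb'.2]⟩ (truncProfile m δ s)
        ⟨by linarith [hss.1], by linarith [hss.2]⟩)
      have h4 : y - x ≤ (1 + δ) * (S * a) := by
        refine (le_abs_self _).trans ((abs_truncProfile_sub_le hδ _ _).trans ?_)
        refine mul_le_mul_of_nonneg_left ((hmL _ _).trans ?_) (by linarith)
        rw [add_sub_cancel_left, abs_of_pos ha]
      have h5 : |x + θ * (y - x) - truncProfile m δ s| ≤ (1 + δ) * (S * a) :=
        (abs_le.2 ⟨by linarith, by linarith⟩ : _ ≤ y - x).trans h4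
      have h6 := mul_le_mul_of_nonneg_left h5 hC
      have h7 := hF.truncProfile_le hm hδ s
      linarith
  · rw [slabDensity, Set.indicator_of_notMem hsR]
    have hcase : truncProfile m δ (b + a) = truncProfile m δ b ∧ F (truncProfile m δ b) = 0 := by
      rw [Set.mem_Icc, not_and_or, not_le, not_le] at hsR
      rcases hsR with h | h
      · rw [hR2 b (by linarith [hs.1]), hR2 (b + a) (by linarith [hs.1])]
        exact ⟨rfl, (hF.zero_iff _).2 (Or.inr rfl)⟩
      · rw [hR1 b (by linarith [hs.2]), hR1 (b + a) (by linarith [hs.2])]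
        exact ⟨rfl, (hF.zero_iff _).2 (Or.inl rfl)⟩
    rw [hcase.1]
    simp [hcase.2]

lemma sq_add_le_young {δ x e E : ℝ} (hδ : 0 < δ) (he : |e| ≤ E) :
    (x + e) ^ 2 ≤ (1 + δ) * x ^ 2 + (1 + 1 / δ) * E ^ 2 := by
  have h1 : e ^ 2 ≤ E ^ 2 := by rw [← sq_abs]; gcongr
  have h2 : (1 + δ) * x ^ 2 + (1 + 1 / δ) * e ^ 2 - (x + e) ^ 2 = (δ * x - e) ^ 2 / δ := by
    field_simp; ring
  have h3 : 0 ≤ (δ * x - e) ^ 2 / δ := by positivity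
  have h4 : (1 + 1 / δ) * e ^ 2 ≤ (1 + 1 / δ) * E ^ 2 := by gcongr
  linarith

section Box

variable {d n : ℕ} {L a r δ R : ℝ} {m : ℝ → ℝ}

lemma Disc.discFun_profile (disc : Disc d L a)
    (hLa : a ≤ L) (hRL : R ≤ L - a) (h1 : ∀ x, R ≤ x → truncProfile m δ x = 1)
    (h2 : ∀ x, x ≤ -R → truncProfile m δ x = -1) (v : Eucl d) (hv : latticePt d a v)
    (hcyl : ∀ i : Fin d, v i.succ ∈ Set.Icc (0 : ℝ) 1) :
    discFun d L a disc (fun z => truncProfile m δ (z.1 0)) v = truncProfile m δ (v 0) := by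
  rcases le_or_gt |v 0| (L - a) with h | h
  · exact disc.discFun_grid _ v ⟨hv, h, hcyl⟩
  · rcases lt_abs.1 h with h | h
    · rw [disc.discFun_pos _ hLa v hv h, h1 _ (by linarith)]
    · rw [disc.discFun_neg _ hLa v hv (by linarith), h2 _ (by linarith)]

lemma Disc.discFun_eq_add_interp0 (disc : Disc d L a) (g g' : gridSet d L a → ℝ) :
    discFun d L a disc g = fun z => discFun d L a disc g' z + disc.interp0 (g - g') z := by
  funext z
  simp [discFun]

lemma edgeInc_add (p : Fin (d + 1) → ℤ) (h k : Eucl d → ℝ) (z : Eucl d) (i : Fin (d + 1)) :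
    edgeInc d a p (fun z => h z + k z) z i = edgeInc d a p h z i + edgeInc d a p k z i := by
  simp only [edgeInc]; ring

lemma Disc.abs_edgeInc_interp0_le (disc : Disc d L a) (e : gridSet d L a → ℝ) (hr : 0 ≤ r)
    (he : ∀ z, |e z| ≤ r) (p : Fin (d + 1) → ℤ) (z : Eucl d) (i : Fin (d + 1)) :
    |edgeInc d a p (disc.interp0 e) z i| ≤ 2 * r := by
  have hb := fun S => abs_le.1 (disc.abs_interp0_le e hr he (vtx d a p S) (vtx_latticePt _ _ _ _))
  rw [edgeInc, abs_le]
  constructor <;> linarith [hb (insert i (dirsAbove d a p z i)), hb (dirsAbove d a p z i)]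

lemma Disc.edgeInc_profile (hn : 0 < n) (ha : a = 1 / n) (disc : Disc d L a)
    (hLa : a ≤ L) (hRL : R ≤ L - a) (h1 : ∀ x, R ≤ x → truncProfile m δ x = 1)
    (h2 : ∀ x, x ≤ -R → truncProfile m δ x = -1) {z : Eucl d}
    (hcyl : ∀ i : Fin d, z i.succ ∈ Set.Ioo (0 : ℝ) 1) (i : Fin (d + 1)) :
    edgeInc d a (fun i => ⌊z i / a⌋) (discFun d L a disc fun z => truncProfile m δ (z.1 0)) z i =
      if i = 0 then truncProfile m δ (a * ⌊z 0 / a⌋ + a) - truncProfile m δ (a * ⌊z 0 / a⌋)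
      else 0 := by
  have hv := fun S => disc.discFun_profile hLa hRL h1 h2 (vtx d a (fun i => ⌊z i / a⌋) S)
    (vtx_latticePt _ _ _ _) (vtx_floor_mem_Icc hn ha hcyl S)
  rw [edgeInc, hv, hv]
  split_ifs with h
  · subst h
    simp [vtx_apply, mem_dirsAbove]
  · simp [vtx_apply, Ne.symm h]

lemma Disc.dirEnergy_le {F : ℝ → ℝ} (hF : IsStdPotential F) (hm : IsProfile F m) {c : ℝ}
    (hδ : 0 < δ) (hR : 0 < R) (hc : 0 ≤ c) (h1 : ∀ x, R ≤ x → truncProfile m δ x = 1)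
    (h2 : ∀ x, x ≤ -R → truncProfile m δ x = -1)
    (hcell : ∀ b s, s ∈ Set.Ioo b (b + a) →
      ((truncProfile m δ (b + a) - truncProfile m δ b) / a) ^ 2 ≤
        2 * (1 + δ) ^ 2 * slabDensity F m (R + 1) (c * a) s)
    (hn : 0 < n) (ha : a = 1 / n) (disc : Disc d L a) (hLa : a ≤ L) (hRL : R ≤ L - a)
    (hr : 0 ≤ r) (g : gridSet d L a → ℝ) (hg : ∀ z, |g z - truncProfile m δ (z.1 0)| ≤ r) :
    dirEnergy d L (discFun d L a disc g) ≤
      2 * (1 + δ) ^ 3 * (Cstar F / 2 + 2 * (R + 1) * (c * a)) +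
        2 * L * ((d + 1) * ((1 + 1 / δ) * (2 * r / a) ^ 2)) := by
  have ha0 : 0 < a := by rw [ha]; positivity
  have hL0 : 0 < L := by linarith
  set D : ℝ := (d + 1) * ((1 + 1 / δ) * (2 * r / a) ^ 2) with hD
  set G : ℝ → ℝ := fun s => 2 * (1 + δ) ^ 3 * slabDensity F m (R + 1) (c * a) s + D with hG
  have hGi1 : IntegrableOn (fun s => 2 * (1 + δ) ^ 3 * slabDensity F m (R + 1) (c * a) s)
      (Set.Ioo (-L) L) :=
    ((slabDensity_integrable hF hm (R + 1) (c * a)).const_mul _).integrableOn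
  have hGi2 : IntegrableOn (fun _ => D) (Set.Ioo (-L) L) := integrableOn_const (by simp)
  have hGi : IntegrableOn G (Set.Ioo (-L) L) := hGi1.add hGi2
  have hle : dirEnergy d L (discFun d L a disc g) ≤ ∫ z in domDL d L, G ((z : Eucl d) 0) := by
    refine integral_mono_of_nonneg (Eventually.of_forall fun z => by positivity)
      (integrableOn_domDL_comp hGi) ?_
    filter_upwards [ae_restrict_mem (measurableSet_domDL d L),
      ae_restrict_of_ae (ae_inCell d ha0),
      ae_restrict_of_ae ((disc.discFun_pl g).ae_norm_fderiv_sq_le ha0)] with z hzD hz hgrad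
    refine hgrad.trans ?_
    rw [disc.discFun_eq_add_interp0 g fun z => truncProfile m δ (z.1 0)]
    have hcell0 := hcell (a * ⌊z 0 / a⌋) (z 0) ⟨by linarith [hz.pos 0], by linarith [hz.lt 0]⟩
    set X := (truncProfile m δ (a * ⌊z 0 / a⌋ + a) - truncProfile m δ (a * ⌊z 0 / a⌋)) / a with hX
    calc _ ≤ ∑ i : Fin (d + 1), ((1 + δ) * (if i = 0 then X else 0) ^ 2 +
          (1 + 1 / δ) * (2 * r / a) ^ 2) := by
          refine Finset.sum_le_sum fun i _ => ?_
          rw [edgeInc_add, disc.edgeInc_profile hn ha hLa hRL h1 h2 hzD.2, add_div]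
          have hE : |edgeInc d a (fun i => ⌊z i / a⌋)
              (disc.interp0 (g - fun z => truncProfile m δ (z.1 0))) z i / a| ≤ 2 * r / a := by
            rw [abs_div, abs_of_pos ha0]
            gcongr
            exact disc.abs_edgeInc_interp0_le _ hr hg _ _ _
          have := sq_add_le_young (x := if i = 0 then X else 0) hδ hE
          rwa [ite_div, zero_div]
      _ = (1 + δ) * X ^ 2 + D := by
          rw [Finset.sum_add_distrib, ← Finset.mul_sum]
          simp [hD, ite_pow, Finset.sum_ite_eq']
      _ ≤ G (z 0) := by
          simp only [hG]
          have := mul_le_mul_of_nonneg_left hcell0 (by linarith : 0 ≤ 1 + δ)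
          linarith
  refine hle.trans ?_
  rw [integral_domDL_comp hGi]
  simp only [hG]
  rw [integral_add hGi1 hGi2, integral_const_mul, setIntegral_const,
    Real.volume_real_Ioo_of_le (by linarith), smul_eq_mul]
  have := setIntegral_slabDensity_le hF hm (by linarith : 0 ≤ R + 1) (by positivity : 0 ≤ c * a)
    (Set.Ioo (-L) L)
  have h3 := mul_le_mul_of_nonneg_left this (by positivity : 0 ≤ 2 * (1 + δ) ^ 3)
  linarith

lemma Disc.potEnergy_le {F : ℝ → ℝ} (hF : IsStdPotential F) (hm : IsProfile F m) {c C : ℝ}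
    (hR : 0 < R) (hc : 0 ≤ c) (hC : 0 ≤ C)
    (hFL : ∀ x ∈ Set.Icc (-2 : ℝ) 2, ∀ y ∈ Set.Icc (-2 : ℝ) 2, |F x - F y| ≤ C * |x - y|)
    (h1 : ∀ x, R ≤ x → truncProfile m δ x = 1)
    (h2 : ∀ x, x ≤ -R → truncProfile m δ x = -1)
    (hcell : ∀ b s, s ∈ Set.Ioo b (b + a) → ∀ θ ∈ Set.Icc (0 : ℝ) 1,
          F (truncProfile m δ b + θ * (truncProfile m δ (b + a) - truncProfile m δ b)) ≤
            slabDensity F m (R + 1) (c * a) s)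
    (hn : 0 < n) (ha : a = 1 / n) (disc : Disc d L a) (hLa : a ≤ L) (hRL : R ≤ L - a)
    (hr : 0 ≤ r) (hr1 : (2 * d + 3) * r ≤ 1)
    (g : gridSet d L a → ℝ) (hg : ∀ z, |g z - truncProfile m δ (z.1 0)| ≤ r) :
    potEnergy d L F (discFun d L a disc g) ≤
      (Cstar F / 2 + 2 * (R + 1) * (c * a)) + 2 * L * (C * ((2 * d + 3) * r)) := by
  have ha0 : 0 < a := by rw [ha]; positivity
  have hL0 : 0 < L := by linarith
  set D : ℝ := C * ((2 * d + 3) * r) with hD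
  set G : ℝ → ℝ := fun s => slabDensity F m (R + 1) (c * a) s + D with hG
  have hGi1 : IntegrableOn (slabDensity F m (R + 1) (c * a)) (Set.Ioo (-L) L) :=
    (slabDensity_integrable hF hm (R + 1) (c * a)).integrableOn
  have hGi2 : IntegrableOn (fun _ => D) (Set.Ioo (-L) L) := integrableOn_const (by simp)
  have hGi : IntegrableOn G (Set.Ioo (-L) L) := hGi1.add hGi2
  have hle : potEnergy d L F (discFun d L a disc g) ≤ ∫ z in domDL d L, G ((z : Eucl d) 0) := by
    refine integral_mono_of_nonneg (Eventually.of_forall fun z => hF.nonneg _)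
      (integrableOn_domDL_comp hGi) ?_
    filter_upwards [ae_restrict_mem (measurableSet_domDL d L),
      ae_restrict_of_ae (ae_inCell d ha0)] with z hzD hz
    rw [disc.discFun_eq_add_interp0 g fun z => truncProfile m δ (z.1 0)]
    have hθ : ∀ i, 0 ≤ (z i - a * ⌊z i / a⌋) / a ∧ (z i - a * ⌊z i / a⌋) / a ≤ 1 := fun i =>
      ⟨div_nonneg (hz.pos i).le ha0.le, (div_le_one ha0).2 (hz.lt i).le⟩
    have hcell0 := hcell (a * ⌊z 0 / a⌋) (z 0) ⟨by linarith [hz.pos 0], by linarith [hz.lt 0]⟩ _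
      (hθ 0)
    have hprof : discFun d L a disc (fun z => truncProfile m δ (z.1 0)) z =
        truncProfile m δ (a * ⌊z 0 / a⌋) + (z 0 - a * ⌊z 0 / a⌋) / a *
          (truncProfile m δ (a * ⌊z 0 / a⌋ + a) - truncProfile m δ (a * ⌊z 0 / a⌋)) := by
      rw [(disc.discFun_pl _).eq_sum ha0 hz, disc.discFun_profile hLa hRL h1 h2 _
        (vtx_latticePt _ _ _ _) (vtx_floor_mem_Icc hn ha hzD.2 _)]
      simp only [disc.edgeInc_profile hn ha hLa hRL h1 h2 hzD.2]
      simp [vtx_apply]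
    have hpert : |disc.interp0 (g - fun z => truncProfile m δ (z.1 0)) z| ≤ (2 * d + 3) * r := by
      rw [(disc.interp0_pl _).eq_sum ha0 hz]
      refine (abs_add_le _ _).trans ?_
      have e1 := disc.abs_interp0_le _ hr hg (vtx d a (fun i => ⌊z i / a⌋) ∅)
        (vtx_latticePt _ _ _ _)
      have e2 : |∑ i, (z i - a * ⌊z i / a⌋) / a * edgeInc d a (fun i => ⌊z i / a⌋)
          (disc.interp0 (g - fun z => truncProfile m δ (z.1 0))) z i| ≤
          ∑ _i : Fin (d + 1), 2 * r := by
        refine (Finset.abs_sum_le_sum_abs _ _).trans (Finset.sum_le_sum fun i _ => ?_)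
        rw [abs_mul, abs_of_nonneg (hθ i).1]
        have e3 := disc.abs_edgeInc_interp0_le _ hr hg (fun i => ⌊z i / a⌋) z i
        exact (mul_le_of_le_one_left (abs_nonneg _) (hθ i).2).trans e3
      simp only [Finset.sum_const, Finset.card_univ, Fintype.card_fin, nsmul_eq_mul] at e2
      push_cast at e2
      refine (add_le_add e1 e2).trans (le_of_eq (by ring))
    beta_reduce
    rw [hprof]
    have hx := truncProfile_mem m δ (a * ⌊z 0 / a⌋)
    have hy := truncProfile_mem m δ (a * ⌊z 0 / a⌋ + a)
    have h0 := hθ 0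
    set x := truncProfile m δ (a * ⌊z 0 / a⌋)
    set y := truncProfile m δ (a * ⌊z 0 / a⌋ + a)
    set θ := (z 0 - a * ⌊z 0 / a⌋) / a
    set k := disc.interp0 (g - fun z => truncProfile m δ (z.1 0)) z
    have hk := abs_le.1 (hpert.trans hr1)
    have hc1 : -1 ≤ x + θ * (y - x) := by nlinarith [h0.1, h0.2, hx.1, hy.1]
    have hc2 : x + θ * (y - x) ≤ 1 := by nlinarith [h0.1, h0.2, hx.2, hy.2]
    have hfin := (le_abs_self _).trans (hFL (x + θ * (y - x) + k)
      ⟨by linarith, by linarith⟩ (x + θ * (y - x)) ⟨by linarith, by linarith⟩)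
    rw [add_sub_cancel_left] at hfin
    have := mul_le_mul_of_nonneg_left hpert hC
    simp only [hG]
    linarith
  refine hle.trans ?_
  rw [integral_domDL_comp hGi]
  simp only [hG]
  rw [integral_add hGi1 hGi2, setIntegral_const,
    Real.volume_real_Ioo_of_le (by linarith), smul_eq_mul]
  have := setIntegral_slabDensity_le hF hm (by linarith : 0 ≤ R + 1) (by positivity : 0 ≤ c * a)
    (Set.Ioo (-L) L)
  linarith

end Box

section Gaussian

variable {ι : Type*} [Fintype ι]

lemma integral_exp_neg_le_of_coercive {f : (ι → ℝ) → ℝ} {ε κ : ℝ} (hε : 0 < ε)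
    (hκ : 0 < κ) (hf : ∀ g, 0 ≤ f g) (hcoer : ∀ g i, (g i - 1) ^ 2 ≤ κ * f g) :
    ∫ g, Real.exp (-(1 / (2 * ε)) * f g) ∂(Measure.pi fun _ : ι => (volume : Measure ℝ)) ≤
      √(2 * π * ε * κ * (Fintype.card ι + 1)) ^ Fintype.card ι := by
  set N : ℝ := (Fintype.card ι : ℝ) with hN
  have hN0 : 0 ≤ N := by positivity
  set b : ℝ := 1 / (2 * ε * κ * (N + 1)) with hb
  have hb0 : 0 < b := by positivity
  have hfint : Integrable (fun x : ℝ => Real.exp (-b * (x - 1) ^ 2)) :=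
    (integrable_exp_neg_mul_sq hb0).comp_sub_right 1
  have hval : ∫ x : ℝ, Real.exp (-b * (x - 1) ^ 2) = √(2 * π * ε * κ * (N + 1)) := by
    rw [integral_sub_right_eq_self (fun x : ℝ => Real.exp (-b * x ^ 2)) (1 : ℝ),
      integral_gaussian]
    congr 1
    rw [hb]
    field_simp
  have hprod : ∫ g : ι → ℝ, ∏ i, Real.exp (-b * (g i - 1) ^ 2)
      ∂(Measure.pi fun _ : ι => (volume : Measure ℝ)) =
      √(2 * π * ε * κ * (N + 1)) ^ Fintype.card ι := by
    rw [integral_fintype_prod_eq_prod (fun _ x => Real.exp (-b * (x - 1) ^ 2))]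
    simp only [hval, Finset.prod_const, Finset.card_univ]
  rw [← hprod]
  refine integral_mono_of_nonneg (Eventually.of_forall fun g => (Real.exp_pos _).le)
    (Integrable.fintype_prod fun _ => hfint) (Eventually.of_forall fun g => ?_)
  beta_reduce
  rw [← Real.exp_sum, Real.exp_le_exp, ← Finset.mul_sum, neg_mul, neg_mul, neg_le_neg_iff]
  have hsum : ∑ i, (g i - 1) ^ 2 ≤ (N + 1) * (κ * f g) := by
    have h1 : ∑ i, (g i - 1) ^ 2 ≤ ∑ _i : ι, κ * f g := Finset.sum_le_sum fun i _ => hcoer g i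
    rw [Finset.sum_const, Finset.card_univ, nsmul_eq_mul] at h1
    have := mul_nonneg hκ.le (hf g)
    nlinarith
  calc b * ∑ i, (g i - 1) ^ 2 ≤ b * ((N + 1) * (κ * f g)) := by gcongr
    _ = 1 / (2 * ε) * f g := by rw [hb]; field_simp

/-- A lower bound for the partition function of a potential `P` with respect to the Gaussian-type
measure with energy `f`, obtained by restricting to a box of half-width `r`. -/
lemma integral_eq_zero_or_box_le {f P : (ι → ℝ) → ℝ} {ε κ r Ef EP : ℝ} {gs : ι → ℝ} (hε : 0 < ε)
    (hκ : 0 < κ) (hr : 0 ≤ r) (hf : ∀ g, 0 ≤ f g) (hcoer : ∀ g i, (g i - 1) ^ 2 ≤ κ * f g)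
    (hEf : ∀ g, (∀ i, |g i - gs i| ≤ r) → f g ≤ Ef)
    (hEP : ∀ g, (∀ i, |g i - gs i| ≤ r) → P g ≤ EP)
    {μ ν : Measure (ι → ℝ)} (hμ : μ = Measure.pi fun _ : ι => (volume : Measure ℝ))
    (hν : ν = μ.withDensity fun g => ENNReal.ofReal
      (Real.exp (-(1 / (2 * ε)) * f g) / ∫ g, Real.exp (-(1 / (2 * ε)) * f g) ∂μ)) :
    ∫ g, Real.exp (-(1 / ε) * P g) ∂ν = 0 ∨
      Real.exp (-(Ef / 2 + EP) / ε) *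
        (2 * r / √(2 * π * ε * κ * (Fintype.card ι + 1))) ^ Fintype.card ι ≤
      ∫ g, Real.exp (-(1 / ε) * P g) ∂ν := by
  set N := Fintype.card ι with hN
  set Z := ∫ g, Real.exp (-(1 / (2 * ε)) * f g) ∂μ with hZ
  set S := √(2 * π * ε * κ * (N + 1)) with hS
  have hS0 : 0 < S := Real.sqrt_pos.2 (by positivity)
  by_cases hfint : Integrable (fun g => Real.exp (-(1 / ε) * P g)) ν
  swap
  · exact Or.inl (integral_undef hfint)
  have hZle : Z ≤ S ^ N := by
    rw [hZ, hμ]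
    exact integral_exp_neg_le_of_coercive hε hκ hf hcoer
  have hZ0 : 0 ≤ Z := integral_nonneg fun g => (Real.exp_pos _).le
  rcases hZ0.eq_or_lt with hZ0 | hZ0
  · left
    have : ν = 0 := by
      rw [hν, ← hZ0]
      simp
    rw [this, integral_zero_measure]
  right
  set B : Set (ι → ℝ) := Set.univ.pi fun i => Set.Icc (gs i - r) (gs i + r) with hB
  have hBm : MeasurableSet B := MeasurableSet.univ_pi fun i => measurableSet_Icc
  have hmem : ∀ g ∈ B, ∀ i, |g i - gs i| ≤ r := fun g hg i => by
    have := hg i (Set.mem_univ i)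
    rw [abs_le]
    constructor <;> linarith [this.1, this.2]
  have hBv : μ B = ENNReal.ofReal ((2 * r) ^ N) := by
    rw [hμ, hB, Measure.pi_pi, ENNReal.ofReal_pow (by positivity)]
    simp only [Real.volume_Icc]
    rw [Finset.prod_congr rfl fun i _ => by
      rw [show gs i + r - (gs i - r) = 2 * r by ring], Finset.prod_const, Finset.card_univ]
  have hνB : ENNReal.ofReal (Real.exp (-(1 / (2 * ε)) * Ef) / Z * (2 * r) ^ N) ≤ ν B := by
    rw [hν, withDensity_apply _ hBm, ENNReal.ofReal_mul (by positivity), ← hBv,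
      ← setLIntegral_const]
    refine setLIntegral_mono' hBm fun g hg => ENNReal.ofReal_le_ofReal ?_
    have := hEf g (hmem g hg)
    refine div_le_div_of_nonneg_right (Real.exp_le_exp.2 ?_) hZ0.le
    have : 1 / (2 * ε) * f g ≤ 1 / (2 * ε) * Ef := by gcongr
    linarith
  have hlow : ENNReal.ofReal (Real.exp (-(1 / ε) * EP) *
      (Real.exp (-(1 / (2 * ε)) * Ef) / Z * (2 * r) ^ N)) ≤
      ENNReal.ofReal (∫ g, Real.exp (-(1 / ε) * P g) ∂ν) := by
    rw [ofReal_integral_eq_lintegral_ofReal hfint (Eventually.of_forall fun g => (Real.exp_pos _).le),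
      ENNReal.ofReal_mul (Real.exp_pos _).le]
    calc _ ≤ ENNReal.ofReal (Real.exp (-(1 / ε) * EP)) * ν B := by gcongr
      _ = ∫⁻ _ in B, ENNReal.ofReal (Real.exp (-(1 / ε) * EP)) ∂ν := by rw [setLIntegral_const]
      _ ≤ ∫⁻ g in B, ENNReal.ofReal (Real.exp (-(1 / ε) * P g)) ∂ν := by
          refine setLIntegral_mono' hBm fun g hg => ENNReal.ofReal_le_ofReal (Real.exp_le_exp.2 ?_)
          have := hEP g (hmem g hg)
          have : 1 / ε * P g ≤ 1 / ε * EP := by gcongr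
          linarith
      _ ≤ _ := setLIntegral_le_lintegral _ _
  rw [ENNReal.ofReal_le_ofReal_iff (integral_nonneg fun g => (Real.exp_pos _).le)] at hlow
  refine le_trans ?_ hlow
  rw [show -(Ef / 2 + EP) / ε = -(1 / ε) * EP + -(1 / (2 * ε)) * Ef by field_simp; ring,
    Real.exp_add, mul_assoc, div_pow, div_mul_eq_mul_div, ← mul_div_assoc]
  gcongr

end Gaussian

lemma Disc.gridCard_le {d n : ℕ} (hn : 0 < n) {L a : ℝ} (ha : a = 1 / n) (hLa : a ≤ L)
    (disc : Disc d L a) : (gridCard d L a disc : ℝ) ≤ 2 * L / a * (2 / a) ^ d := by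
  have ha0 : 0 < a := by rw [ha]; positivity
  have hn1 : (1 : ℝ) ≤ n := by exact_mod_cast hn
  have han : a * n = 1 := by rw [ha]; field_simp
  let _ := disc.gridFin
  set K : ℤ := ⌊(L - a) / a⌋ with hK
  have hK0 : 0 ≤ K := Int.floor_nonneg.2 (div_nonneg (by linarith) ha0.le)
  set T : Finset (Fin (d + 1) → ℤ) :=
    Fintype.piFinset (Fin.cons (Finset.Icc (-K) K) fun _ => Finset.Icc 0 (n : ℤ)) with hT
  choose k hk using fun z : gridSet d L a => z.2.1
  have hkinj : Function.Injective k := fun z z' h => by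
    ext i
    rw [hk z i, hk z' i, h]
  have hkT : ∀ z, k z ∈ T := fun z => by
    rw [hT, Fintype.mem_piFinset]
    intro i
    refine Fin.cases ?_ (fun i => ?_) i
    · rw [Fin.cons_zero, Finset.mem_Icc]
      have h := z.2.2.1
      rw [hk z 0, abs_mul, abs_of_pos ha0] at h
      have h' : ((|k z 0| : ℤ) : ℝ) ≤ (L - a) / a := by
        rw [le_div_iff₀ ha0, Int.cast_abs]
        linarith
      exact abs_le.1 (Int.le_floor.2 h')
    · rw [Fin.cons_succ, Finset.mem_Icc]
      obtain ⟨h1, h2⟩ := z.2.2.2 i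
      rw [hk z i.succ] at h1 h2
      constructor
      · exact_mod_cast nonneg_of_mul_nonneg_right h1 ha0
      · have : (k z i.succ : ℝ) ≤ n := le_of_mul_le_mul_left (by rwa [han]) ha0
        exact_mod_cast this
  have hcard : gridCard d L a disc ≤ T.card :=
    Finset.card_le_card_of_injOn k (fun z _ => hkT z) hkinj.injOn
  have hTc : (T.card : ℝ) = (2 * K + 1) * (n + 1) ^ d := by
    rw [hT, Fintype.card_piFinset, Fin.prod_univ_succ]
    simp only [Fin.cons_zero, Fin.cons_succ, Int.card_Icc, Finset.prod_const, Finset.card_univ,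
      Fintype.card_fin]
    have e1 : (((K + 1 - -K).toNat : ℕ) : ℝ) = 2 * K + 1 := by
      have : (((K + 1 - -K).toNat : ℕ) : ℤ) = 2 * K + 1 := by omega
      exact_mod_cast this
    have e2 : (((n : ℤ) + 1 - 0).toNat : ℕ) = n + 1 := by omega
    rw [e2]
    push_cast [e1]
    ring
  have hKle : (K : ℝ) ≤ L / a - 1 := by
    have h : (K : ℝ) ≤ (L - a) / a := Int.floor_le _
    rwa [sub_div, div_self ha0.ne'] at h
  calc (gridCard d L a disc : ℝ) ≤ T.card := by exact_mod_cast hcard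
    _ = (2 * K + 1) * (n + 1) ^ d := hTc
    _ ≤ 2 * L / a * (2 / a) ^ d := by
        have h1 : (2 * K + 1 : ℝ) ≤ 2 * L / a := by rw [mul_div_assoc]; linarith
        have h2 : (n + 1 : ℝ) ≤ 2 / a := by rw [le_div_iff₀ ha0]; nlinarith
        have : (0 : ℝ) ≤ K := by exact_mod_cast hK0
        gcongr
        exact div_nonneg (by linarith) ha0.le

section Asymptotics

variable {L a : ℝ → ℝ} {lam alp : ℝ}

lemma tendsto_mul_of_asymp {φ : ℝ → ℝ}
    (hL : Tendsto (fun ε : ℝ => L ε * ε ^ lam) (𝓝[>] 0) (𝓝 1))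
    (ha : Tendsto (fun ε : ℝ => a ε / ε ^ alp) (𝓝[>] 0) (𝓝 1)) (i j : ℕ) {k : ℝ}
    (hφ : Tendsto (fun ε : ℝ => φ ε * ε ^ (k - i * lam - j * alp)) (𝓝[>] 0) (𝓝 0)) :
    Tendsto (fun ε => L ε ^ i * ((a ε)⁻¹) ^ j * (φ ε * ε ^ k)) (𝓝[>] 0) (𝓝 0) := by
  have h := ((hL.pow i).mul ((ha.inv₀ one_ne_zero).pow j)).mul hφ
  rw [mul_zero] at h
  refine h.congr' ?_
  filter_upwards [self_mem_nhdsWithin] with ε (hε : 0 < ε)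
  have e1 := Real.rpow_pos_of_pos hε lam
  have e2 := Real.rpow_pos_of_pos hε alp
  rw [Real.rpow_sub hε, Real.rpow_sub hε, mul_comm (i : ℝ), mul_comm (j : ℝ),
    Real.rpow_mul hε.le, Real.rpow_mul hε.le, Real.rpow_natCast, Real.rpow_natCast, inv_div,
    div_pow, mul_pow, inv_pow]
  field_simp

lemma tendsto_rpow_zero {p : ℝ} (hp : 0 < p) :
    Tendsto (fun ε : ℝ => ε ^ p) (𝓝[>] 0) (𝓝 0) := by
  have := (Real.continuousAt_rpow_const 0 p (Or.inr hp.le)).tendsto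
  rw [Real.zero_rpow hp.ne'] at this
  exact this.mono_left nhdsWithin_le_nhds

lemma tendsto_pow_mul_of_asymp
    (hL : Tendsto (fun ε : ℝ => L ε * ε ^ lam) (𝓝[>] 0) (𝓝 1))
    (ha : Tendsto (fun ε : ℝ => a ε / ε ^ alp) (𝓝[>] 0) (𝓝 1)) (i j k : ℕ)
    (h : i * lam + j * alp < k) :
    Tendsto (fun ε => L ε ^ i * ((a ε)⁻¹) ^ j * ε ^ k) (𝓝[>] 0) (𝓝 0) := by
  have := tendsto_mul_of_asymp (φ := fun _ => 1) (k := k) hL ha i j (by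
    simpa using tendsto_rpow_zero (by linarith : 0 < (k : ℝ) - i * lam - j * alp))
  simpa using this

lemma tendsto_pow_mul_log_of_asymp
    (hL : Tendsto (fun ε : ℝ => L ε * ε ^ lam) (𝓝[>] 0) (𝓝 1))
    (ha : Tendsto (fun ε : ℝ => a ε / ε ^ alp) (𝓝[>] 0) (𝓝 1)) (i j k : ℕ)
    (h : i * lam + j * alp < k) :
    Tendsto (fun ε => L ε ^ i * ((a ε)⁻¹) ^ j * (Real.log ε * ε ^ k)) (𝓝[>] 0) (𝓝 0) := by
  have := tendsto_mul_of_asymp (φ := Real.log) (k := k) hL ha i j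
    (tendsto_log_mul_rpow_nhdsGT_zero (by linarith : 0 < (k : ℝ) - i * lam - j * alp))
  simpa using this

lemma tendsto_zero_of_asymp (halp : 0 < alp)
    (ha : Tendsto (fun ε : ℝ => a ε / ε ^ alp) (𝓝[>] 0) (𝓝 1)) :
    Tendsto a (𝓝[>] 0) (𝓝 0) := by
  have h := ha.mul (tendsto_rpow_zero halp)
  rw [mul_zero] at h
  refine h.congr' ?_
  filter_upwards [self_mem_nhdsWithin] with ε (hε : 0 < ε)
  have e2 := Real.rpow_pos_of_pos hε alp
  field_simp

lemma tendsto_atTop_of_asymp (hlam : 0 < lam)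
    (hL : Tendsto (fun ε : ℝ => L ε * ε ^ lam) (𝓝[>] 0) (𝓝 1)) :
    Tendsto L (𝓝[>] 0) atTop := by
  have h0 : Tendsto (fun ε : ℝ => (ε ^ lam)⁻¹) (𝓝[>] 0) atTop := by
    refine tendsto_inv_nhdsGT_zero.comp (tendsto_nhdsWithin_iff.2 ⟨tendsto_rpow_zero hlam, ?_⟩)
    filter_upwards [self_mem_nhdsWithin] with ε (hε : 0 < ε)
    exact Real.rpow_pos_of_pos hε lam
  refine (hL.pos_mul_atTop one_pos h0).congr' ?_
  filter_upwards [self_mem_nhdsWithin] with ε (hε : 0 < ε)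
  have e2 := Real.rpow_pos_of_pos hε lam
  field_simp

end Asymptotics

lemma Disc.partition_eq_zero_or_log_ge {d n : ℕ} {F m : ℝ → ℝ} {L a R δ ε c C : ℝ}
    (hF : IsStdPotential F) (hm : IsProfile F m)
    (hδ : 0 < δ) (hR : 0 < R) (hc : 0 ≤ c) (hC : 0 ≤ C)
    (hFL : ∀ x ∈ Set.Icc (-2 : ℝ) 2, ∀ y ∈ Set.Icc (-2 : ℝ) 2, |F x - F y| ≤ C * |x - y|)
    (h1 : ∀ x, R ≤ x → truncProfile m δ x = 1)
    (h2 : ∀ x, x ≤ -R → truncProfile m δ x = -1)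
    (hcell : ∀ b s, s ∈ Set.Ioo b (b + a) →
      ((truncProfile m δ (b + a) - truncProfile m δ b) / a) ^ 2 ≤
          2 * (1 + δ) ^ 2 * slabDensity F m (R + 1) (c * a) s ∧
        ∀ θ ∈ Set.Icc (0 : ℝ) 1,
          F (truncProfile m δ b + θ * (truncProfile m δ (b + a) - truncProfile m δ b)) ≤
            slabDensity F m (R + 1) (c * a) s)
    (hn : 0 < n) (ha : a = 1 / n) (disc : Disc d L a) (hLa : a ≤ L) (hRL : R ≤ L - a)
    (hε : 0 < ε) (hε1 : (2 * d + 3) * ε ≤ 1)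
    (hκ : 4 * L ^ 2 * (3 / a) ^ (d + 1) * (2 * L / a * (2 / a) ^ d + 1) * ε ^ 4 ≤ 1) :
    ∫ g, Real.exp (-(1 / ε) * potEnergy d L F (discFun d L a disc g)) ∂(nu1 d L a disc ε) = 0 ∨
      -(((1 + δ) ^ 3 + 1) * (Cstar F / 2 + 2 * (R + 1) * (c * a)) +
          L * ((d + 1) * ((1 + 1 / δ) * (2 * ε / a) ^ 2)) + 2 * L * (C * ((2 * d + 3) * ε))) +
        ε * (2 * L / a * (2 / a) ^ d * (3 * Real.log ε)) ≤
      ε * Real.log (∫ g, Real.exp (-(1 / ε) * potEnergy d L F (discFun d L a disc g))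
        ∂(nu1 d L a disc ε)) := by
  have ha0 : 0 < a := by rw [ha]; positivity
  have hL0 : 0 < L := by linarith
  let _ := disc.gridFin
  have hN : (Fintype.card (gridSet d L a) : ℝ) ≤ 2 * L / a * (2 / a) ^ d :=
    disc.gridCard_le hn ha hLa
  set κ : ℝ := 4 * L ^ 2 * (3 / a) ^ (d + 1) with hκdef
  have hκ0 : 0 < κ := by positivity
  have key := integral_eq_zero_or_box_le (ι := gridSet d L a)
    (f := fun g => dirEnergy d L (discFun d L a disc g))
    (P := fun g => potEnergy d L F (discFun d L a disc g))
    (gs := fun z => truncProfile m δ (z.1 0)) hε hκ0 hε.le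
    (fun g => integral_nonneg fun _ => by positivity)
    (fun g z => disc.coercive hn ha hLa g z)
    (fun g hg => disc.dirEnergy_le hF hm hδ hR hc h1 h2 (fun b s hs => (hcell b s hs).1) hn ha
      hLa hRL hε.le g hg)
    (fun g hg => disc.potEnergy_le hF hm hR hc hC hFL h1 h2 (fun b s hs => (hcell b s hs).2) hn ha
      hLa hRL hε.le hε1 g hg) (μ := gridVol d L a disc) (ν := nu1 d L a disc ε) rfl rfl
  refine key.imp_right fun h => ?_
  set N := Fintype.card (gridSet d L a) with hNdef
  have hε2 : ε ≤ 1 / 3 := by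
    have : (0 : ℝ) ≤ d := by positivity
    nlinarith
  have hlog : Real.log ε ≤ 0 := Real.log_nonpos hε.le (by linarith)
  set S := √(2 * π * ε * κ * (N + 1)) with hS
  have hS0 : 0 < S := Real.sqrt_pos.2 (by positivity)
  have hq : ε ^ 3 ≤ 2 * ε / S := by
    rw [le_div_iff₀ hS0, ← sq_le_sq₀ (by positivity) (by positivity), mul_pow, hS,
      Real.sq_sqrt (by positivity)]
    have hκN : κ * (N + 1) * ε ^ 4 ≤ 1 := le_trans (by gcongr) hκ
    calc (ε ^ 3) ^ 2 * (2 * π * ε * κ * (N + 1)) = 2 * π * ε ^ 3 * (κ * (N + 1) * ε ^ 4) := by ring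
      _ ≤ 2 * π * ε ^ 3 * 1 := by gcongr
      _ = 2 * ε ^ 2 * (π * ε) := by ring
      _ ≤ 2 * ε ^ 2 * 2 := by
          gcongr
          nlinarith [Real.pi_lt_four]
      _ = (2 * ε) ^ 2 := by ring
  have hq0 : 0 < 2 * ε / S := by positivity
  have hlogq : 3 * Real.log ε ≤ Real.log (2 * ε / S) := by
    have := Real.log_le_log (by positivity) hq
    rwa [Real.log_pow, Nat.cast_ofNat] at this
  have h3 := Real.log_le_log (by positivity) h
  rw [Real.log_mul (Real.exp_pos _).ne' (by positivity), Real.log_exp, Real.log_pow] at h3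
  have h4 : 2 * L / a * (2 / a) ^ d * (3 * Real.log ε) ≤ N * Real.log (2 * ε / S) :=
    le_trans (mul_le_mul_of_nonpos_right hN (by linarith)) (by gcongr)
  have h5 := mul_le_mul_of_nonneg_left ((add_le_add_right h4 _).trans h3) hε.le
  refine le_trans (le_of_eq ?_) h5
  field_simp
  ring

lemma exists_delta_mul_le {A η : ℝ} (hη : 0 < η) :
    ∃ δ : ℝ, 0 < δ ∧ ((1 + δ) ^ 3 + 1) * (A / 2) ≤ A + η := by
  have h : Tendsto (fun δ : ℝ => ((1 + δ) ^ 3 + 1) * (A / 2)) (𝓝[>] 0) (𝓝 A) := by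
    have : Continuous fun δ : ℝ => ((1 + δ) ^ 3 + 1) * (A / 2) := by fun_prop
    have h0 := this.tendsto 0
    rw [show ((1 + (0 : ℝ)) ^ 3 + 1) * (A / 2) = A by ring] at h0
    exact h0.mono_left nhdsWithin_le_nhds
  obtain ⟨δ, h1, h2⟩ := ((h.eventually_le_const (lt_add_of_pos_right A hη)).and
    self_mem_nhdsWithin).exists
  exact ⟨δ, h2, h1⟩

lemma le_liminf_of_forall_pos {α : Type*} {l : Filter α} {f : α → ℝ} {A : ℝ} (hA : A ≤ 0)
    (h : ∀ η > 0, ∀ᶠ x in l, A - η ≤ f x) : A ≤ Filter.liminf f l := by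
  rw [Filter.liminf_eq]
  by_cases hb : BddAbove {b | ∀ᶠ x in l, b ≤ f x}
  · exact le_of_forall_sub_le fun η hη => le_csSup hb (h η hη)
  · rwa [Real.sSup_of_not_bddAbove hb]

lemma eventually_neg_Cstar_sub_le (d : ℕ) (F m : ℝ → ℝ) (hF : IsStdPotential F)
    (hm : IsProfile F m) (lam alp : ℝ) (hlam : 0 < lam) (halp : 0 < alp)
    (hsum : lam + (d + 1 : ℝ) * alp < 1) (L a : ℝ → ℝ)
    (hLasymp : Tendsto (fun ε : ℝ => L ε * ε ^ lam) (𝓝[>] (0:ℝ)) (𝓝 1))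
    (haasymp : Tendsto (fun ε : ℝ => a ε / ε ^ alp) (𝓝[>] (0:ℝ)) (𝓝 1))
    {η : ℝ} (hη : 0 < η) :
    ∀ᶠ ε in 𝓝[>] (0 : ℝ), ∀ (disc : Disc d (L ε) (a ε)), (∃ n : ℕ, 0 < n ∧ a ε = 1 / n) →
      -Cstar F - η ≤ ε * Real.log (∫ g, Real.exp (-(1/ε) *
              potEnergy d (L ε) F (discFun d (L ε) (a ε) disc g))
            ∂(nu1 d (L ε) (a ε) disc ε)) := by
  obtain ⟨δ, hδ, hδη⟩ := exists_delta_mul_le (A := Cstar F) (half_pos hη)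
  obtain ⟨C, hC, hFL⟩ := hF.exists_lipschitz
  obtain ⟨R, c, hR, hc, h1, h2, hcell⟩ := hm.truncProfile_cell hF hδ
  have hd0 : (0 : ℝ) ≤ d := by positivity
  have hda : 0 ≤ (d : ℝ) * alp := by positivity
  have ha0 := tendsto_zero_of_asymp halp haasymp
  have hLtop := tendsto_atTop_of_asymp hlam hLasymp
  have hid : Tendsto (fun ε : ℝ => ε) (𝓝[>] 0) (𝓝 0) := tendsto_id.mono_left nhdsWithin_le_nhds
  have t1 := tendsto_pow_mul_of_asymp hLasymp haasymp 1 2 2 (by push_cast; linarith)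
  have t2 := tendsto_pow_mul_of_asymp hLasymp haasymp 1 0 1 (by push_cast; linarith)
  have t3 := tendsto_pow_mul_log_of_asymp hLasymp haasymp 1 (d + 1) 1 (by push_cast; linarith)
  have t4 := tendsto_pow_mul_of_asymp hLasymp haasymp 3 (2 * d + 1 + 1) 4 (by
    push_cast; linarith)
  have t5 := tendsto_pow_mul_of_asymp hLasymp haasymp 2 (d + 1) 4 (by push_cast; linarith)
  have hκ := (t4.const_mul (4 * 3 ^ (d + 1) * (2 * 2 ^ d))).add (t5.const_mul (4 * 3 ^ (d + 1)))
  have herr := (((ha0.const_mul (((1 + δ) ^ 3 + 1) * (2 * (R + 1) * c))).add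
    (t1.const_mul ((d + 1) * (1 + 1 / δ) * 4))).add (t2.const_mul (2 * C * (2 * d + 3)))).sub
    (t3.const_mul (2 * 2 ^ d * 3))
  simp only [mul_zero, add_zero, sub_zero] at hκ herr
  filter_upwards [self_mem_nhdsWithin, ha0.eventually_le_const one_pos,
    hLtop.eventually_ge_atTop (R + 1),
    (hid.const_mul (2 * (d : ℝ) + 3)).eventually_le_const (by rw [mul_zero]; exact one_pos),
    hκ.eventually_le_const one_pos, herr.eventually_le_const (half_pos hη)] with
    ε (hε : 0 < ε) ha1 hL1 hε1 hκ1 herr1 disc ⟨n, hn, han⟩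
  have hapos : 0 < a ε := by rw [han]; positivity
  rcases disc.partition_eq_zero_or_log_ge hF hm hδ hR hc hC hFL h1 h2 (hcell _ hapos ha1) hn han
    (by linarith) (by linarith) hε hε1 (by
      refine le_trans (le_of_eq ?_) hκ1
      simp only [div_eq_mul_inv]
      ring) with h | h
  · rw [h, Real.log_zero, mul_zero]
    linarith [Cstar_nonneg F]
  · refine le_trans ?_ h
    have e : ((1 + δ) ^ 3 + 1) * (Cstar F / 2 + 2 * (R + 1) * (c * a ε)) +
        L ε * ((d + 1) * ((1 + 1 / δ) * (2 * ε / a ε) ^ 2)) +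
        2 * L ε * (C * ((2 * d + 3) * ε)) -
        ε * (2 * L ε / a ε * (2 / a ε) ^ d * (3 * Real.log ε)) =
        ((1 + δ) ^ 3 + 1) * (Cstar F / 2) +
        (((1 + δ) ^ 3 + 1) * (2 * (R + 1) * c) * a ε +
          (d + 1) * (1 + 1 / δ) * 4 * (L ε ^ 1 * (a ε)⁻¹ ^ 2 * ε ^ 2) +
          2 * C * (2 * d + 3) * (L ε ^ 1 * (a ε)⁻¹ ^ 0 * ε ^ 1) -
          2 * 2 ^ d * 3 * (L ε ^ 1 * (a ε)⁻¹ ^ (d + 1) * (Real.log ε * ε ^ 1))) := by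
      simp only [div_eq_mul_inv]
      ring
    linarith

/-- Asymptotic lower bound for the normalization constant
`Z^ε = ∫ exp(-ε⁻¹ ∫_{D_L} F(h)) ν₁^ε(dh)`: under `L(ε) ~ ε^{-λ}`, `a(ε) ~ ε^α`,
`λ + (d+1)α < 1`, one has `liminf_{ε→0} ε log Z^ε ≥ -C*`. -/
theorem statement19 (d : ℕ) (F m : ℝ → ℝ) (hF : IsStdPotential F) (hm : IsProfile F m)
    (lam alp : ℝ) (hlam : 0 < lam) (halp : 0 < alp)
    (hsum : lam + (d + 1 : ℝ) * alp < 1)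
    (L a : ℝ → ℝ)
    (hLasymp : Tendsto (fun ε : ℝ => L ε * ε ^ lam) (𝓝[>] (0:ℝ)) (𝓝 1))
    (haasymp : Tendsto (fun ε : ℝ => a ε / ε ^ alp) (𝓝[>] (0:ℝ)) (𝓝 1))
    (ε₁ : ℝ) (hε₁ : 0 < ε₁)
    (hmesh : ∀ ε ∈ Set.Ioo (0:ℝ) ε₁, ∃ n : ℕ, 0 < n ∧ a ε = 1 / n)
    (disc : ∀ ε ∈ Set.Ioo (0:ℝ) ε₁, Disc d (L ε) (a ε)) :
    -Cstar F ≤ Filter.liminf (fun ε : ℝ =>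
        if hε : ε ∈ Set.Ioo (0:ℝ) ε₁ then
          ε * Real.log (∫ g, Real.exp (-(1/ε) *
              potEnergy d (L ε) F (discFun d (L ε) (a ε) (disc ε hε) g))
            ∂(nu1 d (L ε) (a ε) (disc ε hε) ε))
        else 0) (𝓝[>] (0:ℝ)) := by
  refine le_liminf_of_forall_pos (neg_nonpos.2 (Cstar_nonneg F)) fun η hη => ?_
  filter_upwards [Ioo_mem_nhdsGT hε₁, eventually_neg_Cstar_sub_le d F m hF hm lam alp hlam halp
    hsum L a hLasymp haasymp hη] with ε hε h
  rw [dif_pos hε]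
  exact h (disc ε hε) (hmesh ε hε)


end
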